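/- For convex bodies K_m in ℝⁿ (n ≥ 2) and j ∈ {1,…,n-1}, one has V_{j+1}(K) ≤ C_{n,j}·V_j(K)^{(j+1)/j}, where C_{n,j} = κ_n^{-1/j}·κ_{n-j-1}^{-1}·κ_{n-j}^{(j+1)/j}·binom(n,j+1)·binom(n,j)^{-(j+1)/j}. -/

import Mathlib

open MeasureTheory Metric Matrix
open scoped RealInnerProductSpace Pointwise

noncomputable section

abbrev Euc (n : ℕ) := EuclideanSpace ℝ (Fin n)

/-- The support function of a set `K ⊆ ℝⁿ`. -/
def suppFn {n : ℕ} (K : Set (Euc n)) (x : Euc n) : ℝ :=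
  sSup ((fun y => ⟪x, y⟫) '' K)

/-- `κ_d`, the volume of the `d`-dimensional Euclidean unit ball. -/
def kappa (d : ℕ) : ℝ := (volume (ball (0 : Euc d) 1)).toReal

/-- The `(n-1)`-dimensional Hausdorff measure on the unit sphere. -/
def sphM (n : ℕ) : Measure (Euc n) := (μH[(n : ℝ) - 1]).restrict (sphere (0 : Euc n) 1)

/-- The Wulff shape of `f`: the largest convex body whose support function is dominated by `f`. -/
def wulff {n : ℕ} (f : Euc n → ℝ) : Set (Euc n) :=
  {x | ∀ u : Euc n, ‖u‖ = 1 → ⟪x, u⟫ ≤ f u}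

/-- The `p`-combination `((1-λ)a^p + λb^p)^{1/p}` (geometric mean for `p = 0`). -/
def combP (p lam a b : ℝ) : ℝ :=
  if p = 0 then a ^ (1 - lam) * b ^ lam
  else ((1 - lam) * a ^ p + lam * b ^ p) ^ (1 / p)

/-- The Hessian matrix (in the standard coordinates of `ℝⁿ`) of `h : ℝⁿ → ℝ` at `u`. -/
def hessMat {n : ℕ} (h : Euc n → ℝ) (u : Euc n) : Matrix (Fin n) (Fin n) ℝ :=
  Matrix.of fun i k =>
    fderiv ℝ (fun x => fderiv ℝ h x (EuclideanSpace.single k 1)) u (EuclideanSpace.single i 1)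

/-- `s_j`: the normalized `j`-th elementary symmetric function of the principal radii of
curvature (for a 1-homogeneous `h`, the `j`-th elementary symmetric function of the eigenvalues
of the full Hessian at `u`, read off the characteristic polynomial). -/
def sjFun (n j : ℕ) (h : Euc n → ℝ) (u : Euc n) : ℝ :=
  (((n - 1).choose j : ℝ))⁻¹ * ((-1 : ℝ) ^ j * ((hessMat h u).charpoly.coeff (n - j)))

/-- A function `V : ℕ → Set ℝⁿ → ℝ` realizes the intrinsic volumes via the Steiner formula. -/
def steiner (n : ℕ) (V : ℕ → Set (Euc n) → ℝ) : Prop :=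
  ∀ K : Set (Euc n), IsCompact K → Convex ℝ K → K.Nonempty → ∀ ρ : ℝ, 0 < ρ →
    (volume (K + closedBall (0 : Euc n) ρ)).toReal
      = ∑ i ∈ Finset.range (n + 1), ρ ^ (n - i) * kappa (n - i) * V i K

lemma bm1_compact (A B : Set ℝ) (hA : IsCompact A) (hB : IsCompact B) (hAn : A.Nonempty)
    (hBn : B.Nonempty) (C : Set ℝ) (hC : ∀ a ∈ A, ∀ b ∈ B, a + b ∈ C) :
    volume A + volume B ≤ volume C := by
  obtain ⟨M, hMA, hM⟩ := hA.exists_isGreatest hAn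
  obtain ⟨m, hmB, hm⟩ := hB.exists_isLeast hBn
  have h1 : volume A = volume ((fun x => m + x) '' A) := by
    rw [Set.image_add_left, measure_preimage_add]
  have h2 : volume B = volume ((fun x => M + x) '' B) := by
    rw [Set.image_add_left, measure_preimage_add]
  have hcB : IsCompact ((fun x => M + x) '' B) := hB.image (by fun_prop)
  rw [h1, h2, ← measure_union₀]
  · apply measure_mono
    rintro x (⟨a, ha, rfl⟩ | ⟨b, hb, rfl⟩)
    · simpa [add_comm] using hC a ha m hmB
    · exact hC M hMA b hb
  · exact hcB.measurableSet.nullMeasurableSet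
  · refine measure_mono_null (t := {M + m}) ?_ (by simp)
    rintro x ⟨⟨a, ha, rfl⟩, ⟨b, hb, hx⟩⟩
    have := hM ha
    have := hm hb
    have hx' : M + b = m + a := hx
    change m + a = M + m
    linarith

lemma bm1 (A B : Set ℝ) (hA : MeasurableSet A) (hB : MeasurableSet B) (hAn : A.Nonempty)
    (hBn : B.Nonempty) (C : Set ℝ) (hC : ∀ a ∈ A, ∀ b ∈ B, a + b ∈ C) :
    volume A + volume B ≤ volume C := by
  obtain ⟨a, ha⟩ := hAn
  obtain ⟨b, hb⟩ := hBn
  have key : ∀ K ⊆ A, IsCompact K → ∀ L ⊆ B, IsCompact L → volume K + volume L ≤ volume C := by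
    intro K hK hKc L hL hLc
    refine le_trans (add_le_add (measure_mono (Set.subset_insert a K))
      (measure_mono (Set.subset_insert b L))) ?_
    refine bm1_compact _ _ (hKc.insert a) (hLc.insert b) (Set.insert_nonempty _ _)
      (Set.insert_nonempty _ _) C ?_
    intro x hx y hy
    exact hC x (Set.insert_subset ha hK hx) y (Set.insert_subset hb hL hy)
  have step : ∀ L ⊆ B, IsCompact L → volume A + volume L ≤ volume C := by
    intro L hL hLc
    have : volume A ≤ volume C - volume L := by
      rw [hA.measure_eq_iSup_isCompact]
      refine iSup₂_le fun K hK => iSup_le fun hKc => ?_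
      exact ENNReal.le_sub_of_add_le_right hLc.measure_lt_top.ne (key K hK hKc L hL hLc)
    calc volume A + volume L ≤ volume C - volume L + volume L := by gcongr
      _ = volume C := tsub_add_cancel_of_le
        (le_add_self.trans (key ∅ (by simp) isCompact_empty L hL hLc))
  by_cases hAt : volume A = ⊤
  · have := step ∅ (by simp) isCompact_empty
    rw [hAt] at this ⊢
    simpa using this
  have : volume B ≤ volume C - volume A := by
    rw [hB.measure_eq_iSup_isCompact]
    refine iSup₂_le fun K hK => iSup_le fun hKc => ?_
    exact ENNReal.le_sub_of_add_le_left hAt (step K hK hKc)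
  calc volume A + volume B ≤ volume A + (volume C - volume A) := by gcongr
    _ = volume C := add_tsub_cancel_of_le
        (le_self_add.trans (step ∅ (by simp) isCompact_empty))

lemma ennreal_amgm (x y z : ENNReal) (h : x + y ≤ 2 * z) : x * y ≤ z ^ 2 := by
  by_cases hz : z = ⊤
  · subst hz; simp
  have h2 : 2 * z ≠ ⊤ := ENNReal.mul_ne_top (by simp) hz
  have hx : x ≠ ⊤ := ne_top_of_le_ne_top h2 (le_trans le_self_add h)
  have hy : y ≠ ⊤ := ne_top_of_le_ne_top h2 (le_trans le_add_self h)
  lift x to NNReal using hx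
  lift y to NNReal using hy
  lift z to NNReal using hz
  norm_cast at h ⊢
  have h' : (x : ℝ) + y ≤ 2 * z := by exact_mod_cast h
  have : (x : ℝ) * y ≤ z ^ 2 := by
    nlinarith [sq_nonneg ((x : ℝ) - y), x.2, y.2, z.2, mul_self_le_mul_self (by positivity) h']
  exact_mod_cast this

lemma pl1_norm (f g h : ℝ → ℝ) (hf : Measurable f) (hg : Measurable g) (hh : Measurable h)
    (hf0 : ∀ x, 0 ≤ f x) (hg0 : ∀ x, 0 ≤ g x) (hh0 : ∀ x, 0 ≤ h x)
    (hf1 : ∀ x, f x ≤ 1) (hg1 : ∀ x, g x ≤ 1)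
    (hfs : ∀ r < 1, ∃ x, r < f x) (hgs : ∀ r < 1, ∃ x, r < g x)
    (H : ∀ x y, f x * g y ≤ h ((x + y) / 2) ^ 2) :
    (∫⁻ x, ENNReal.ofReal (f x)) * (∫⁻ x, ENNReal.ofReal (g x))
      ≤ (∫⁻ x, ENNReal.ofReal (h x)) ^ 2 := by
  apply ennreal_amgm
  rw [lintegral_eq_lintegral_meas_lt volume (Filter.Eventually.of_forall hf0) hf.aemeasurable,
    lintegral_eq_lintegral_meas_lt volume (Filter.Eventually.of_forall hg0) hg.aemeasurable,
    lintegral_eq_lintegral_meas_lt volume (Filter.Eventually.of_forall hh0) hh.aemeasurable]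
  rw [← lintegral_const_mul' _ _ (by simp), ← lintegral_add_left']
  swap
  · apply Measurable.aemeasurable
    apply Antitone.measurable
    intro s t hst
    exact measure_mono fun a ha => lt_of_le_of_lt hst ha
  refine setLIntegral_mono' measurableSet_Ioi ?_
  intro r hr
  have hr : 0 < r := hr
  by_cases hr1 : 1 ≤ r
  · have e1 : {a | r < f a} = ∅ := by
      ext x; simpa using (hf1 x).trans hr1
    have e2 : {a | r < g a} = ∅ := by
      ext x; simpa using (hg1 x).trans hr1
    simp [e1, e2]
  · push Not at hr1
    have := bm1 {a | r < f a} {a | r < g a} (measurableSet_lt measurable_const hf)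
      (measurableSet_lt measurable_const hg) (hfs r hr1) (hgs r hr1)
      ((fun x => (2:ℝ)⁻¹ * x) ⁻¹' {a | r < h a}) (by
        intro a ha b hb
        simp only [Set.mem_preimage, Set.mem_ofPred_eq] at *
        have h1 := H a b
        rw [show (2:ℝ)⁻¹ * (a + b) = (a + b) / 2 by ring]
        by_contra hcon
        push Not at hcon
        have h2 := hh0 ((a+b)/2)
        nlinarith)
    refine this.trans (le_of_eq ?_)
    rw [Real.volume_preimage_mul_left (by norm_num)]
    simp

lemma pl1 (f g h : ℝ → ℝ) (hf : Measurable f) (hg : Measurable g) (hh : Measurable h)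
    (hf0 : ∀ x, 0 ≤ f x) (hg0 : ∀ x, 0 ≤ g x) (hh0 : ∀ x, 0 ≤ h x)
    (hf1 : BddAbove (Set.range f)) (hg1 : BddAbove (Set.range g))
    (H : ∀ x y, f x * g y ≤ h ((x + y) / 2) ^ 2) :
    (∫⁻ x, ENNReal.ofReal (f x)) * (∫⁻ x, ENNReal.ofReal (g x))
      ≤ (∫⁻ x, ENNReal.ofReal (h x)) ^ 2 := by
  set a := ⨆ x, f x with ha
  set b := ⨆ x, g x with hb
  have hfa : ∀ x, f x ≤ a := fun x => le_ciSup hf1 x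
  have hgb : ∀ x, g x ≤ b := fun x => le_ciSup hg1 x
  have ha0 : 0 ≤ a := (hf0 0).trans (hfa 0)
  have hb0 : 0 ≤ b := (hg0 0).trans (hgb 0)
  rcases ha0.eq_or_lt with ha' | ha'
  · have : f = 0 := by ext x; exact le_antisymm ((hfa x).trans ha'.symm.le) (hf0 x)
    simp [this]
  rcases hb0.eq_or_lt with hb' | hb'
  · have : g = 0 := by ext x; exact le_antisymm ((hgb x).trans hb'.symm.le) (hg0 x)
    simp [this]
  have hs : 0 < Real.sqrt (a * b) := Real.sqrt_pos.mpr (by positivity)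
  have key := pl1_norm (fun x => a⁻¹ * f x) (fun x => b⁻¹ * g x)
    (fun x => (Real.sqrt (a * b))⁻¹ * h x) (by fun_prop) (by fun_prop) (by fun_prop)
    (fun x => mul_nonneg (by positivity) (hf0 x)) (fun x => mul_nonneg (by positivity) (hg0 x))
    (fun x => mul_nonneg (by positivity) (hh0 x))
    (fun x => by rw [inv_mul_le_iff₀ ha']; simpa using hfa x)
    (fun x => by rw [inv_mul_le_iff₀ hb']; simpa using hgb x)
    (fun r hr => by
      obtain ⟨x, hx⟩ := exists_lt_of_lt_ciSup (show a * r < ⨆ x, f x by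
        rw [← ha]; nlinarith)
      exact ⟨x, by rwa [lt_inv_mul_iff₀ ha']⟩)
    (fun r hr => by
      obtain ⟨x, hx⟩ := exists_lt_of_lt_ciSup (show b * r < ⨆ x, g x by
        rw [← hb]; nlinarith)
      exact ⟨x, by rwa [lt_inv_mul_iff₀ hb']⟩)
    (fun x y => by
      rw [mul_pow, inv_pow, Real.sq_sqrt (by positivity), mul_inv]
      calc a⁻¹ * f x * (b⁻¹ * g y) = a⁻¹ * b⁻¹ * (f x * g y) := by ring
        _ ≤ _ := by gcongr; exact H x y)
  simp only [ENNReal.ofReal_mul (inv_nonneg.mpr ha0), ENNReal.ofReal_mul (inv_nonneg.mpr hb0),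
    ENNReal.ofReal_mul (inv_nonneg.mpr hs.le)] at key
  rw [lintegral_const_mul' _ _ (by simp), lintegral_const_mul' _ _ (by simp),
    lintegral_const_mul' _ _ (by simp), mul_pow, ← ENNReal.ofReal_pow (by positivity),
    inv_pow, Real.sq_sqrt (by positivity), mul_inv, ENNReal.ofReal_mul (by positivity)] at key
  have e1 : ENNReal.ofReal a * ENNReal.ofReal a⁻¹ = 1 := by
    rw [← ENNReal.ofReal_mul ha0, mul_inv_cancel₀ ha'.ne']; simp
  have e2 : ENNReal.ofReal b * ENNReal.ofReal b⁻¹ = 1 := by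
    rw [← ENNReal.ofReal_mul hb0, mul_inv_cancel₀ hb'.ne']; simp
  set F := ∫⁻ x, ENNReal.ofReal (f x)
  set G := ∫⁻ x, ENNReal.ofReal (g x)
  set Hh := ∫⁻ x, ENNReal.ofReal (h x)
  calc F * G = (ENNReal.ofReal a * ENNReal.ofReal a⁻¹) * (ENNReal.ofReal b * ENNReal.ofReal b⁻¹)
        * (F * G) := by rw [e1, e2]; simp
    _ = ENNReal.ofReal a * ENNReal.ofReal b *
        (ENNReal.ofReal a⁻¹ * F * (ENNReal.ofReal b⁻¹ * G)) := by ring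
    _ ≤ ENNReal.ofReal a * ENNReal.ofReal b *
        (ENNReal.ofReal a⁻¹ * ENNReal.ofReal b⁻¹ * Hh ^ 2) := by gcongr
    _ = (ENNReal.ofReal a * ENNReal.ofReal a⁻¹) * (ENNReal.ofReal b * ENNReal.ofReal b⁻¹)
        * Hh ^ 2 := by ring
    _ = _ := by rw [e1, e2]; simp

/-- Brunn-Minkowski, midpoint multiplicative form. -/
lemma bmN (n : ℕ) : ∀ (A B C : Set (Fin n → ℝ)), IsCompact A → IsCompact B → IsCompact C →
    (∀ a ∈ A, ∀ b ∈ B, (2:ℝ)⁻¹ • (a + b) ∈ C) → volume A * volume B ≤ volume C ^ 2 := by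
  induction n with
  | zero =>
    intro A B C _ _ _ h
    rcases A.eq_empty_or_nonempty with rfl | hA
    · simp
    rcases B.eq_empty_or_nonempty with rfl | hB
    · simp
    obtain ⟨a, ha⟩ := hA
    obtain ⟨b, hb⟩ := hB
    have hC : C = Set.univ := Set.eq_univ_of_forall fun x => by
      rw [Subsingleton.elim x]; exact h a ha b hb
    have hA : A = Set.univ := Set.eq_univ_of_forall fun x => by
      rw [Subsingleton.elim x a]; exact ha
    have hB : B = Set.univ := Set.eq_univ_of_forall fun x => by
      rw [Subsingleton.elim x b]; exact hb
    have hu : volume (Set.univ : Set (Fin 0 → ℝ)) = 1 := by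
      rw [volume_pi, Measure.pi_univ]; simp
    rw [hA, hB, hC, hu]; simp
  | succ n ih =>
    intro A B C hA hB hC h
    have sl : ∀ (D : Set (Fin (n+1) → ℝ)), IsCompact D →
        (∀ s, IsCompact {y : Fin n → ℝ | (Fin.cons s y : Fin (n+1) → ℝ) ∈ D}) ∧
        (Measurable fun s : ℝ => (volume {y : Fin n → ℝ | (Fin.cons s y : Fin (n+1) → ℝ) ∈ D}).toReal)
        ∧ (BddAbove (Set.range fun s : ℝ =>
            (volume {y : Fin n → ℝ | (Fin.cons s y : Fin (n+1) → ℝ) ∈ D}).toReal)) ∧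
        volume D = ∫⁻ s, ENNReal.ofReal
          (volume {y : Fin n → ℝ | (Fin.cons s y : Fin (n+1) → ℝ) ∈ D}).toReal := by
      intro D hD
      have hc : ∀ s, Continuous (fun y : Fin n → ℝ => (Fin.cons s y : Fin (n+1) → ℝ)) := by
        intro s; fun_prop
      have hP : IsCompact ((fun x : Fin (n+1) → ℝ => (fun i => x (Fin.succ i) : Fin n → ℝ)) '' D) :=
        hD.image (by fun_prop)
      have hsub : ∀ s, {y : Fin n → ℝ | (Fin.cons s y : Fin (n+1) → ℝ) ∈ D} ⊆
          ((fun x : Fin (n+1) → ℝ => (fun i => x (Fin.succ i) : Fin n → ℝ)) '' D) := by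
        intro s y hy
        exact ⟨_, hy, by ext i; simp⟩
      have hcp : ∀ s, IsCompact {y : Fin n → ℝ | (Fin.cons s y : Fin (n+1) → ℝ) ∈ D} := fun s =>
        hP.of_isClosed_subset (hD.isClosed.preimage (hc s)) (hsub s)
      have mp := (volume_preserving_piFinSuccAbove (fun _ : Fin (n+1) => ℝ) 0).symm
      have hms : MeasurableSet ((MeasurableEquiv.piFinSuccAbove (fun _ : Fin (n+1) => ℝ) 0).symm ⁻¹' D) :=
        (MeasurableEquiv.measurable _) hD.measurableSet
      have hsl : ∀ s, Prod.mk s ⁻¹' ((MeasurableEquiv.piFinSuccAbove (fun _ : Fin (n+1) => ℝ) 0).symm ⁻¹' D)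
          = {y : Fin n → ℝ | (Fin.cons s y : Fin (n+1) → ℝ) ∈ D} := by
        intro s; ext y
        simp [MeasurableEquiv.piFinSuccAbove, Fin.insertNthEquiv]
      refine ⟨hcp, ?_, ?_, ?_⟩
      · have := (measurable_measure_prodMk_left (ν := (volume : Measure (Fin n → ℝ))) hms).ennreal_toReal
        simpa only [hsl] using this
      · refine ⟨(volume ((fun x : Fin (n+1) → ℝ => (fun i => x (Fin.succ i) : Fin n → ℝ)) '' D)).toReal, ?_⟩
        rintro _ ⟨s, rfl⟩
        exact ENNReal.toReal_mono hP.measure_lt_top.ne (measure_mono (hsub s))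
      · rw [← mp.measure_preimage hD.measurableSet.nullMeasurableSet]
        change (volume.prod volume) _ = _
        rw [Measure.prod_apply hms]
        congr 1; ext s
        rw [hsl, ENNReal.ofReal_toReal (hcp s).measure_lt_top.ne]
    obtain ⟨cA, mA, bA, eA⟩ := sl A hA
    obtain ⟨cB, mB, bB, eB⟩ := sl B hB
    obtain ⟨cC, mC, -, eC⟩ := sl C hC
    rw [eA, eB, eC]
    refine pl1 _ _ _ mA mB mC (fun _ => ENNReal.toReal_nonneg) (fun _ => ENNReal.toReal_nonneg)
      (fun _ => ENNReal.toReal_nonneg) bA bB ?_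
    intro s t
    rw [← ENNReal.toReal_mul, ← ENNReal.toReal_pow]
    refine ENNReal.toReal_mono (ENNReal.pow_ne_top (cC _).measure_lt_top.ne) ?_
    refine ih _ _ _ (cA _) (cB _) (cC _) ?_
    intro a ha b hb
    have := h _ ha _ hb
    simp only [Set.mem_ofPred_eq]
    convert this using 1
    ext i
    refine Fin.cases ?_ (fun i => ?_) i
    · simp; ring
    · simp; ring

lemma bmE (n : ℕ) (A B C : Set (EuclideanSpace ℝ (Fin n))) (hA : IsCompact A) (hB : IsCompact B)
    (hC : IsCompact C) (h : ∀ a ∈ A, ∀ b ∈ B, (2:ℝ)⁻¹ • (a + b) ∈ C) :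
    volume A * volume B ≤ volume C ^ 2 := by
  have mp := PiLp.volume_preserving_toLp (Fin n)
  have e : ∀ D : Set (EuclideanSpace ℝ (Fin n)), IsCompact D →
      volume D = volume ((WithLp.toLp 2 : (Fin n → ℝ) → _) ⁻¹' D) ∧
      IsCompact ((WithLp.toLp 2 : (Fin n → ℝ) → EuclideanSpace ℝ (Fin n)) ⁻¹' D) := by
    intro D hD
    refine ⟨(mp.measure_preimage hD.measurableSet.nullMeasurableSet).symm, ?_⟩
    have := hD.image (f := (WithLp.ofLp : EuclideanSpace ℝ (Fin n) → _)) (by fun_prop)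
    convert this using 1
    ext x
    constructor
    · intro hx; exact ⟨_, hx, rfl⟩
    · rintro ⟨y, hy, rfl⟩; exact hy
  rw [(e A hA).1, (e B hB).1, (e C hC).1]
  refine bmN n _ _ _ (e A hA).2 (e B hB).2 (e C hC).2 ?_
  intro a ha b hb
  exact h _ ha _ hb

/-- Bilinear form of a matrix. -/
def bilF {σ : Type*} [Fintype σ] (M : σ → σ → ℝ) (v w : σ → ℝ) : ℝ := ∑ i, v i * ∑ j, M i j * w j

/-- At most one positive direction (reverse Cauchy-Schwarz). -/
def HypF {σ : Type*} [Fintype σ] (M : σ → σ → ℝ) : Prop :=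
  ∀ v y : σ → ℝ, 0 < bilF M y y → bilF M v v * bilF M y y ≤ (bilF M v y) ^ 2

section linalg
variable {σ : Type*} [Fintype σ]

lemma bilF_add_left (M : σ → σ → ℝ) (v w y : σ → ℝ) :
    bilF M (v + w) y = bilF M v y + bilF M w y := by
  simp [bilF, add_mul, Finset.sum_add_distrib]

lemma bilF_smul_left (M : σ → σ → ℝ) (c : ℝ) (v y : σ → ℝ) :
    bilF M (c • v) y = c * bilF M v y := by
  simp [bilF, Finset.mul_sum, mul_assoc]

lemma bilF_symm (M : σ → σ → ℝ) (hM : ∀ i j, M i j = M j i) (v w : σ → ℝ) :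
    bilF M v w = bilF M w v := by
  simp only [bilF, Finset.mul_sum]
  rw [Finset.sum_comm]
  refine Finset.sum_congr rfl fun i _ => Finset.sum_congr rfl fun j _ => ?_
  rw [hM j i]; ring

lemma hypF_of_one (M : σ → σ → ℝ) (hM : ∀ i j, M i j = M j i) (x : σ → ℝ)
    (h : ∀ v, bilF M v x = 0 → bilF M v v ≤ 0) : HypF M := by
  intro v y hy
  have hyx : bilF M y x ≠ 0 := fun h0 => absurd (h y h0) (not_le.mpr hy)
  set t := bilF M v x / bilF M y x with ht
  have h1 := h (v + (-t) • y) (by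
    rw [bilF_add_left, bilF_smul_left, ht]; field_simp; ring)
  rw [bilF_add_left, bilF_smul_left, bilF_symm M hM v, bilF_symm M hM y, bilF_add_left,
    bilF_add_left, bilF_smul_left, bilF_smul_left, bilF_symm M hM y v] at h1
  nlinarith [sq_nonneg (bilF M v y - t * bilF M y y)]

lemma hypF_zero (M : σ → σ → ℝ) (hM : ∀ i j, M i j = 0) : HypF M := by
  intro v y hy
  simp [bilF, hM] at hy

lemma hypF_smul (M : σ → σ → ℝ) (c : ℝ) (hc : 0 < c) (h : HypF M) :
    HypF (fun i j => c * M i j) := by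
  have e : ∀ v w, bilF (fun i j => c * M i j) v w = c * bilF M v w := by
    intro v w
    simp only [bilF, Finset.mul_sum]
    refine Finset.sum_congr rfl fun i _ => Finset.sum_congr rfl fun j _ => ?_
    ring
  intro v y hy
  rw [e] at hy
  have := h v y (pos_of_mul_pos_right hy hc.le)
  simp only [e]
  have hc2 : 0 < c ^ 2 := by positivity
  nlinarith

lemma hypF_tendsto {α : Type*} {l : Filter α} [l.NeBot] (M : α → σ → σ → ℝ) (N : σ → σ → ℝ)
    (h : ∀ᶠ a in l, HypF (M a)) (ht : ∀ i j, Filter.Tendsto (fun a => M a i j) l (nhds (N i j))) :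
    HypF N := by
  have e : ∀ v w, Filter.Tendsto (fun a => bilF (M a) v w) l (nhds (bilF N v w)) := by
    intro v w
    refine tendsto_finsetSum _ fun i _ => Filter.Tendsto.const_mul _ ?_
    exact tendsto_finsetSum _ fun j _ => (ht i j).mul_const _
  intro v y hy
  refine le_of_tendsto_of_tendsto ((e v v).mul (e y y)) ((e v y).pow 2) ?_
  filter_upwards [h, (e y y).eventually (lt_mem_nhds hy)] with a h1 h2
  exact h1 v y h2

lemma spec_core {E : Type*} [NormedAddCommGroup E] [InnerProductSpace ℝ E] [FiniteDimensional ℝ E]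
    (T : E →ₗ[ℝ] E) (hT : T.IsSymmetric) (w : E)
    (h1 : ∀ v, ⟪T v, v⟫ ≤ ⟪T v, T v⟫) (h2 : ∀ v, ⟪T v, v⟫ ≤ ⟪v, v⟫)
    (h3 : ∀ v, ⟪T v, v⟫ = ⟪v, v⟫ → ∃ c : ℝ, v = c • w) (v : E) (hv : ⟪w, v⟫ = 0) :
    ⟪T v, v⟫ ≤ 0 := by
  set b := hT.eigenvectorBasis rfl
  set μ := hT.eigenvalues rfl
  have hb : ∀ i, T (b i) = μ i • b i := fun i => hT.apply_eigenvectorBasis rfl i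
  have hbb : ∀ i, ⟪b i, b i⟫ = 1 := fun i => by
    rw [real_inner_self_eq_norm_sq, b.orthonormal.1 i]; norm_num
  rw [← b.sum_inner_mul_inner]
  refine Finset.sum_nonpos fun i _ => ?_
  rw [hT v (b i), hb i, inner_smul_right, real_inner_comm (b i) v]
  have a1 := h1 (b i)
  have a2 := h2 (b i)
  have a3 := h3 (b i)
  rw [hb i, inner_smul_left, inner_smul_left, inner_smul_right, hbb] at a1
  rw [hb i, inner_smul_left, hbb] at a2 a3
  simp only [conj_trivial, mul_one] at a1 a2 a3
  rcases le_or_gt (μ i) 0 with h0 | h0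
  · nlinarith [sq_nonneg (⟪b i, v⟫)]
  · have : μ i = 1 := by nlinarith
    obtain ⟨c, hc⟩ := a3 this
    rw [hc, inner_smul_left, hv]; simp

lemma spec_weighted (M : σ → σ → ℝ) (hM : ∀ i j, M i j = M j i) (D w : σ → ℝ) (hD : ∀ i, 0 < D i)
    (h1 : ∀ v, bilF M v v ≤ ∑ i, (∑ j, M i j * v j) ^ 2 / D i)
    (h2 : ∀ v, bilF M v v ≤ ∑ i, D i * v i ^ 2)
    (h3 : ∀ v, bilF M v v = ∑ i, D i * v i ^ 2 → ∃ c : ℝ, v = c • w)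
    (v : σ → ℝ) (hv : ∑ i, D i * w i * v i = 0) : bilF M v v ≤ 0 := by
  set r : σ → ℝ := fun i => Real.sqrt (D i) with hr
  have hr0 : ∀ i, 0 < r i := fun i => Real.sqrt_pos.mpr (hD i)
  have hr2 : ∀ i, r i * r i = D i := fun i => Real.mul_self_sqrt (hD i).le
  let T : EuclideanSpace ℝ σ →ₗ[ℝ] EuclideanSpace ℝ σ :=
    { toFun := fun u => WithLp.toLp 2 (fun i => (r i)⁻¹ * ∑ j, M i j * ((r j)⁻¹ * u j))
      map_add' := by
        intro a b; ext i
        simp [mul_add, Finset.sum_add_distrib]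
      map_smul' := by
        intro c a; ext i
        simp only [PiLp.smul_apply, smul_eq_mul, Finset.mul_sum, RingHom.id_apply]
        refine Finset.sum_congr rfl fun j _ => ?_
        ring }
  have hTa : ∀ u i, T u i = (r i)⁻¹ * ∑ j, M i j * ((r j)⁻¹ * u j) := fun u i => rfl
  have hin : ∀ a b : EuclideanSpace ℝ σ, ⟪a, b⟫ = ∑ i, a i * b i := by
    intro a b; simp [PiLp.inner_apply, mul_comm]
  have hTb : ∀ a b : EuclideanSpace ℝ σ, ⟪T a, b⟫ =
      bilF M (fun i => (r i)⁻¹ * b i) (fun i => (r i)⁻¹ * a i) := by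
    intro a b
    rw [hin, bilF]
    refine Finset.sum_congr rfl fun i _ => ?_
    rw [hTa]; ring
  have hsy : T.IsSymmetric := by
    intro a b
    rw [hTb, real_inner_comm, hTb, bilF_symm M hM]
  have hn : ∀ u : EuclideanSpace ℝ σ, ⟪u, u⟫ = ∑ i, D i * ((r i)⁻¹ * u i) ^ 2 := by
    intro u; rw [hin]
    refine Finset.sum_congr rfl fun i _ => ?_
    rw [← hr2]; have := (hr0 i).ne'; field_simp
  have key := spec_core T hsy (WithLp.toLp 2 (fun i => r i * w i)) (by
      intro u
      rw [hTb, hin]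
      refine (h1 _).trans (le_of_eq ?_)
      refine Finset.sum_congr rfl fun i _ => ?_
      rw [hTa, ← hr2]; have := (hr0 i).ne'; field_simp) (by
      intro u
      rw [hTb, hn]; exact h2 _) (by
      intro u hu
      rw [hTb, hn] at hu
      obtain ⟨c, hc⟩ := h3 _ hu
      refine ⟨c, ?_⟩
      ext i
      have := congrFun hc i
      simp only [Pi.smul_apply, smul_eq_mul] at this
      simp only [PiLp.smul_apply, smul_eq_mul]
      rw [inv_mul_eq_iff_eq_mul₀ (hr0 i).ne'] at this
      rw [this]; ring) (WithLp.toLp 2 (fun i => r i * v i)) (by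
      rw [hin, ← hv]
      refine Finset.sum_congr rfl fun i _ => ?_
      rw [← hr2]; simp; ring)
  rw [hTb] at key
  have e : (fun i => (r i)⁻¹ * (WithLp.toLp 2 (fun i => r i * v i) : EuclideanSpace ℝ σ) i) = v := by
    ext i; have := (hr0 i).ne'; simp; field_simp
  rwa [e] at key

/-- The Bochner step in matrix form. -/
lemma bochner (d : ℝ) (hd : 2 < d) (H : σ → σ → ℝ) (hs : ∀ i j, H i j = H j i)
    (G : σ → σ → σ → ℝ) (g x : σ → ℝ) (hx : ∀ i, 0 < x i) (hH0 : ∀ i j, 0 ≤ H i j)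
    (E1 : ∀ i, ∑ j, H i j * x j = (d - 1) * g i)
    (E2 : ∀ i j, ∑ k, x k * G k i j = (d - 2) * H i j)
    (E3 : ∀ k i, ∑ j, G k i j * x j = (d - 2) * H i k)
    (hG : ∀ k, HypF (G k)) (o : σ)
    (ho : ∀ k, (∀ i j, G k i j = 0) ∧ (∀ i, H i k = 0) ∨ 0 < H o k) : HypF H := by
  classical
  have hg0 : ∀ i, 0 ≤ g i := by
    intro i
    have : 0 ≤ (d - 1) * g i := by
      rw [← E1]; exact Finset.sum_nonneg fun j _ => mul_nonneg (hH0 i j) (hx j).le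
    exact nonneg_of_mul_nonneg_right this (by linarith)
  have hlive : ∀ k, 0 < H o k → 0 < g k := by
    intro k hk
    have : 0 < (d - 1) * g k := by
      rw [← E1]
      refine lt_of_lt_of_le ?_ (Finset.single_le_sum
        (fun j _ => mul_nonneg (hH0 k j) (hx j).le) (Finset.mem_univ o))
      rw [hs k o]; exact mul_pos hk (hx o)
    exact pos_of_mul_pos_right this (by linarith)
  have hdead : ∀ k, ¬ 0 < H o k → g k = 0 := by
    intro k hk
    rcases ho k with h | h
    · have : (d - 1) * g k = 0 := by
        rw [← E1]; exact Finset.sum_eq_zero fun j _ => by rw [hs k j, h.2]; ring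
      rcases mul_eq_zero.mp this with h | h
      · linarith
      · exact h
    · exact absurd h hk
  set D : σ → ℝ := fun i => if 0 < H o i then g i / x i else 1 with hD
  set w : σ → ℝ := fun i => if 0 < H o i then x i else 0 with hw
  have hD0 : ∀ i, 0 < D i := by
    intro i; simp only [hD]; split_ifs with h
    · exact div_pos (hlive i h) (hx i)
    · norm_num
  have hd1 : 0 < d - 1 := by linarith
  have hd2 : 0 < d - 2 := by linarith
  -- Perron identity
  have perron : ∀ v : σ → ℝ, ∑ i, ∑ j, H i j * x i * x j * (v i / x i - v j / x j) ^ 2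
      = 2 * ((d - 1) * ∑ i, g i / x i * v i ^ 2 - bilF H v v) := by
    intro v
    have e1 : ∀ i j, H i j * x i * x j * (v i / x i - v j / x j) ^ 2 =
        (v i ^ 2 / x i * (H i j * x j) + v j ^ 2 / x j * (H j i * x i))
          - 2 * (v i * (H i j * v j)) := by
      intro i j
      rw [hs j i]
      have := (hx i).ne'
      have := (hx j).ne'
      field_simp; ring
    simp only [e1, Finset.sum_sub_distrib, Finset.sum_add_distrib]
    rw [Finset.sum_comm (f := fun i j => v j ^ 2 / x j * (H j i * x i))]
    simp only [← Finset.mul_sum, E1, bilF]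
    have : ∀ i, v i ^ 2 / x i * ((d - 1) * g i) = (d - 1) * (g i / x i * v i ^ 2) := by
      intro i; ring
    simp only [this, ← Finset.mul_sum]
    ring
  have hDg : ∀ i, g i / x i ≤ D i := by
    intro i; simp only [hD]; split_ifs with h
    · exact le_rfl
    · rw [hdead i h]; simp
  set M : σ → σ → ℝ := fun i j => (d - 1)⁻¹ * H i j with hM
  have hMb : ∀ v w, bilF M v w = (d - 1)⁻¹ * bilF H v w := by
    intro v w
    simp only [bilF, hM, Finset.mul_sum]
    refine Finset.sum_congr rfl fun i _ => Finset.sum_congr rfl fun j _ => ?_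
    ring
  have hterm : ∀ (v : σ → ℝ) i j, 0 ≤ H i j * x i * x j * (v i / x i - v j / x j) ^ 2 := by
    intro v i j
    have := hH0 i j; have := (hx i).le; have := (hx j).le
    positivity
  have core := spec_weighted M (fun i j => by simp only [hM]; rw [hs i j]) D w hD0
    (by
      intro v
      have hk : ∀ k, x k * bilF (G k) v v ≤
          (d - 2) * (d - 1) * ((∑ j, M k j * v j) ^ 2 / D k) := by
        intro k
        by_cases hl : 0 < H o k
        · have b1 : bilF (G k) v x = (d - 2) * ∑ j, H k j * v j := by
            simp only [bilF, E3, Finset.mul_sum]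
            refine Finset.sum_congr rfl fun i _ => ?_
            rw [hs i k]; ring
          have b2 : bilF (G k) x x = (d - 2) * ((d - 1) * g k) := by
            simp only [bilF, E3]
            rw [← E1, Finset.mul_sum]
            refine Finset.sum_congr rfl fun i _ => ?_
            rw [hs i k]; ring
          have hgk := hlive k hl
          have b3 := hG k v x (by rw [b2]; positivity)
          rw [b1, b2] at b3
          have b4 : (∑ j, M k j * v j) = (d - 1)⁻¹ * ∑ j, H k j * v j := by
            simp only [hM, Finset.mul_sum, mul_assoc]
          rw [b4]
          simp only [hD, if_pos hl]
          set S := ∑ j, H k j * v j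
          have hxk := hx k
          have b5 : bilF (G k) v v ≤ (d - 2) * S ^ 2 / ((d - 1) * g k) := by
            rw [le_div_iff₀ (by positivity)]
            have : 0 ≤ (d - 2) * ((d - 2) * S ^ 2 - bilF (G k) v v * ((d - 1) * g k)) := by
              nlinarith
            have := nonneg_of_mul_nonneg_right this hd2
            linarith
          calc x k * bilF (G k) v v ≤ x k * ((d - 2) * S ^ 2 / ((d - 1) * g k)) := by gcongr
            _ = _ := by field_simp
        · rcases ho k with h | h
          · have : bilF (G k) v v = 0 := by simp [bilF, h.1]
            rw [this, mul_zero]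
            have := hD0 k
            positivity
          · exact absurd h hl
      have hsum : ∑ k, x k * bilF (G k) v v = (d - 2) * bilF H v v := by
        simp only [bilF, Finset.mul_sum]
        rw [Finset.sum_comm]
        refine Finset.sum_congr rfl fun i _ => ?_
        rw [Finset.sum_comm]
        refine Finset.sum_congr rfl fun j _ => ?_
        have := E2 i j
        calc _ = v i * v j * ∑ k, x k * G k i j := by
              rw [Finset.mul_sum]; exact Finset.sum_congr rfl fun k _ => by ring
          _ = _ := by rw [this]; ring
      have := Finset.sum_le_sum fun k (_ : k ∈ Finset.univ) => hk k
      rw [hsum, ← Finset.mul_sum, mul_assoc] at this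
      have := le_of_mul_le_mul_left this hd2
      rw [hMb, inv_mul_le_iff₀ hd1]; exact this)
    (by
      intro v
      have h1 := perron v
      have h2 : 0 ≤ ∑ i, ∑ j, H i j * x i * x j * (v i / x i - v j / x j) ^ 2 :=
        Finset.sum_nonneg fun i _ => Finset.sum_nonneg fun j _ => hterm v i j
      have h3 : ∑ i, g i / x i * v i ^ 2 ≤ ∑ i, D i * v i ^ 2 :=
        Finset.sum_le_sum fun i _ => mul_le_mul_of_nonneg_right (hDg i) (sq_nonneg _)
      rw [hMb, inv_mul_le_iff₀ hd1]
      nlinarith)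
    (by
      intro v hv
      have h1 := perron v
      have h3 : ∀ i, g i / x i * v i ^ 2 ≤ D i * v i ^ 2 := fun i =>
        mul_le_mul_of_nonneg_right (hDg i) (sq_nonneg _)
      have h3' := Finset.sum_le_sum fun i (_ : i ∈ Finset.univ) => h3 i
      have h2 : 0 ≤ ∑ i, ∑ j, H i j * x i * x j * (v i / x i - v j / x j) ^ 2 :=
        Finset.sum_nonneg fun i _ => Finset.sum_nonneg fun j _ => hterm v i j
      rw [hMb, inv_mul_eq_iff_eq_mul₀ hd1.ne'] at hv
      have h4 : ∑ i, ∑ j, H i j * x i * x j * (v i / x i - v j / x j) ^ 2 = 0 := by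
        refine le_antisymm ?_ h2
        rw [h1, hv]; nlinarith
      have h5 : ∑ i, g i / x i * v i ^ 2 = ∑ i, D i * v i ^ 2 := by
        rw [h4, hv] at h1
        have : (d - 1) * (∑ i, g i / x i * v i ^ 2 - ∑ i, D i * v i ^ 2) = 0 := by linarith
        rcases mul_eq_zero.mp this with h | h <;> linarith
      rw [Finset.sum_eq_sum_iff_of_le fun i _ => h3 i] at h5
      rw [Finset.sum_eq_zero_iff_of_nonneg fun i _ =>
        Finset.sum_nonneg fun j _ => hterm v i j] at h4
      refine ⟨v o / x o, ?_⟩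
      ext i
      simp only [hw, Pi.smul_apply, smul_eq_mul]
      split_ifs with h
      · have h6 := h4 o (Finset.mem_univ o)
        rw [Finset.sum_eq_zero_iff_of_nonneg fun j _ => hterm v o j] at h6
        have h7 := h6 i (Finset.mem_univ i)
        have hp : 0 < H o i * x o * x i := mul_pos (mul_pos h (hx o)) (hx i)
        have h8 : v o / x o - v i / x i = 0 := by
          rcases mul_eq_zero.mp h7 with h | h
          · exact absurd h hp.ne'
          · exact pow_eq_zero_iff (two_ne_zero) |>.mp h
        have : v o / x o = v i / x i := by linarith
        rw [this, div_mul_cancel₀ _ (hx i).ne']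
      · have h6 := h5 i (Finset.mem_univ i)
        rw [hdead i h] at h6
        simp only [hD, if_neg h] at h6
        have : v i ^ 2 = 0 := by
          rw [zero_div, zero_mul, one_mul] at h6; exact h6.symm
        rw [pow_eq_zero_iff two_ne_zero] at this
        rw [this]; simp)
  refine hypF_of_one H hs x ?_
  intro v hv
  have hv' : ∑ i, D i * w i * v i = 0 := by
    have : ∀ i, D i * w i * v i = g i * v i := by
      intro i
      simp only [hD, hw]
      split_ifs with h
      · rw [div_mul_cancel₀ _ (hx i).ne']
      · rw [hdead i h]; ring
    simp only [this]
    simp only [bilF, E1] at hv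
    have h : (d - 1) * ∑ i, g i * v i = 0 := by
      rw [← hv, Finset.mul_sum]; exact Finset.sum_congr rfl fun i _ => by ring
    rcases mul_eq_zero.mp h with h | h
    · linarith
    · exact h
  have := core v hv'
  rw [hMb] at this
  by_contra hc
  push Not at hc
  have : 0 < (d - 1)⁻¹ * bilF H v v := by positivity
  linarith

end linalg

section poly
open MvPolynomial
variable {σ : Type*} [Fintype σ] [DecidableEq σ]

lemma pd_comm {σ : Type*} (i j : σ) (f : MvPolynomial σ ℝ) :
    pderiv i (pderiv j f) = pderiv j (pderiv i f) := by
  classical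
  ext m
  rw [coeff_pderiv, coeff_pderiv, coeff_pderiv, coeff_pderiv]
  by_cases h : i = j
  · subst h; ring
  · rw [add_right_comm]
    simp [Finsupp.single_apply, h, Ne.symm h]
    ring

/-- Hessian of a polynomial. -/
def hessP {σ : Type*} (f : MvPolynomial σ ℝ) (x : σ → ℝ) : σ → σ → ℝ :=
  fun i j => eval x (pderiv i (pderiv j f))

/-- Lorentzian on the open orthant. -/
def LorP {σ : Type*} [Fintype σ] (f : MvPolynomial σ ℝ) : Prop :=
  ∀ x : σ → ℝ, (∀ i, 0 < x i) → HypF (hessP f x)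

lemma hasDerivAt_eval_line (f : MvPolynomial σ ℝ) (x v : σ → ℝ) (t : ℝ) :
    HasDerivAt (fun s : ℝ => eval (x + s • v) f) (∑ i, v i * eval (x + t • v) (pderiv i f)) t := by
  classical
  induction f using MvPolynomial.induction_on with
  | C a => simpa using hasDerivAt_const t a
  | add p q hp hq =>
    simp only [map_add, mul_add, Finset.sum_add_distrib]
    exact hp.add hq
  | mul_X p i hp =>
    simp only [map_mul, eval_X, Derivation.leibniz, map_add, smul_eq_mul, pderiv_X]
    have h1 : HasDerivAt (fun s : ℝ => (x + s • v) i) (v i) t := by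
      simp only [Pi.add_apply, Pi.smul_apply, smul_eq_mul]
      simpa using ((hasDerivAt_id t).mul_const (v i)).const_add (x i)
    refine (hp.fun_mul h1).congr_deriv ?_
    symm
    simp only [mul_add, Finset.sum_add_distrib, Finset.sum_mul]
    rw [add_comm]
    congr 1
    · exact Finset.sum_congr rfl fun j _ => by ring
    · rw [Finset.sum_eq_single i]
      · simp; ring
      · intro j _ hj
        simp [Pi.single_apply, hj.symm]
      · simp

lemma eval_affine (g : MvPolynomial σ ℝ) (i : σ) (h : pderiv i (pderiv i g) = 0) (x : σ → ℝ)
    (s : ℝ) : eval (x + s • Pi.single i 1) g = eval x g + s * eval x (pderiv i g) := by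
  have hsum : ∀ (q : MvPolynomial σ ℝ) (y : σ → ℝ),
      ∑ k, (Pi.single i 1 : σ → ℝ) k * eval y (pderiv k q) = eval y (pderiv i q) := by
    intro q y
    rw [Finset.sum_eq_single i]
    · simp
    · intro j _ hj; simp [Pi.single_apply, hj]
    · simp
  have d1 : ∀ t, HasDerivAt (fun s : ℝ => eval (x + s • (Pi.single i 1 : σ → ℝ)) (pderiv i g)) 0 t := by
    intro t
    have := hasDerivAt_eval_line (pderiv i g) x (Pi.single i 1) t
    rw [hsum, h] at this
    simpa using this
  have c1 : ∀ t : ℝ, eval (x + t • (Pi.single i 1 : σ → ℝ)) (pderiv i g) = eval x (pderiv i g) := by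
    intro t
    have := is_const_of_deriv_eq_zero (fun t => (d1 t).differentiableAt) (fun t => (d1 t).deriv) t 0
    simpa using this
  have d2 : ∀ t, HasDerivAt (fun s : ℝ => eval (x + s • Pi.single i 1) g
      - s * eval x (pderiv i g)) 0 t := by
    intro t
    have := (hasDerivAt_eval_line g x (Pi.single i 1) t).fun_sub
      ((hasDerivAt_id t).mul_const (eval x (pderiv i g)))
    rw [hsum, c1] at this
    simpa using this
  have := is_const_of_deriv_eq_zero (fun t => (d2 t).differentiableAt) (fun t => (d2 t).deriv) s 0
  simp at this
  linarith

lemma lor_pderiv (f : MvPolynomial σ ℝ) (i : σ) (h : pderiv i (pderiv i f) = 0) (hf : LorP f) :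
    LorP (pderiv i f) := by
  intro x hx
  refine hypF_tendsto (l := Filter.atTop)
    (fun s : ℝ => fun a b => s⁻¹ * hessP f (x + s • Pi.single i 1) a b) _ ?_ ?_
  · filter_upwards [Filter.eventually_gt_atTop 0] with s hs
    refine hypF_smul _ _ (by positivity) (hf _ ?_)
    intro j
    have := hx j
    have : 0 ≤ (Pi.single i 1 : σ → ℝ) j := by
      by_cases h : j = i <;> simp [Pi.single_apply, h]
    simp only [Pi.add_apply, Pi.smul_apply, smul_eq_mul]
    positivity
  · intro a b
    have e : ∀ s : ℝ, hessP f (x + s • Pi.single i 1) a b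
        = hessP f x a b + s * hessP (pderiv i f) x a b := by
      intro s
      simp only [hessP]
      rw [eval_affine _ i (by
        rw [pd_comm i a, pd_comm i a, pd_comm i b, pd_comm i b, h]; simp)]
      rw [pd_comm i a, pd_comm i b]
    have : Filter.Tendsto (fun s : ℝ => s⁻¹ * hessP f x a b + hessP (pderiv i f) x a b)
        Filter.atTop (nhds (0 * hessP f x a b + hessP (pderiv i f) x a b)) :=
      (tendsto_inv_atTop_zero.mul_const _).add_const _
    rw [zero_mul, zero_add] at this
    refine this.congr' ?_
    filter_upwards [Filter.eventually_gt_atTop 0] with s hs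
    rw [e]; field_simp

lemma euler_eval (f : MvPolynomial σ ℝ) (n : ℕ) (h : f.IsHomogeneous n) (x : σ → ℝ) :
    ∑ i, x i * eval x (pderiv i f) = n * eval x f := by
  have := congrArg (eval x) h.sum_X_mul_pderiv
  simpa using this

lemma hom_iter (o : σ) (f : MvPolynomial σ ℝ) (n k : ℕ) (h : f.IsHomogeneous (n + k)) :
    ((pderiv o)^[k] f).IsHomogeneous n := by
  induction k generalizing f with
  | zero => simpa using h
  | succ k ih =>
    rw [Function.iterate_succ_apply]
    exact ih _ (by simpa using h.pderiv (i := o))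

lemma pd_comm_iter (o i : σ) (k : ℕ) (f : MvPolynomial σ ℝ) :
    pderiv i ((pderiv o)^[k] f) = (pderiv o)^[k] (pderiv i f) := by
  induction k generalizing f with
  | zero => rfl
  | succ k ih => rw [Function.iterate_succ_apply, ih, Function.iterate_succ_apply, pd_comm]

lemma eval_iter (o : σ) (k : ℕ) : ∀ (g : MvPolynomial σ ℝ), g.IsHomogeneous k → ∀ x : σ → ℝ,
    eval x ((pderiv o)^[k] g) = (k.factorial : ℝ) * eval (Pi.single o 1) g := by
  induction k with
  | zero =>
    intro g hg x
    have : g = C (coeff 0 g) := by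
      rw [← totalDegree_eq_zero_iff_eq_C]
      exact Nat.le_zero.mp hg.totalDegree_le
    rw [this]; simp
  | succ k ih =>
    intro g hg x
    rw [Function.iterate_succ_apply, ih _ (by simpa using hg.pderiv (i := o))]
    have := euler_eval g _ hg (Pi.single o 1)
    rw [Finset.sum_eq_single o] at this
    · simp only [Pi.single_eq_same, one_mul] at this
      rw [this, Nat.factorial_succ]; push_cast; ring
    · intro j _ hj; simp [Pi.single_apply, hj]
    · simp

lemma continuous_eval' (f : MvPolynomial σ ℝ) : Continuous fun x : σ → ℝ => eval x f :=
  MvPolynomial.continuous_eval f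

lemma lor_base (o : σ) (k : ℕ) (f : MvPolynomial σ ℝ) (hf : f.IsHomogeneous (k + 2))
    (hl : LorP f) : LorP ((pderiv o)^[k] f) := by
  intro x _
  have e : hessP ((pderiv o)^[k] f) x = fun a b =>
      (k.factorial : ℝ) * hessP f (Pi.single o 1) a b := by
    ext a b
    simp only [hessP]
    rw [pd_comm_iter, pd_comm_iter, eval_iter]
    exact (hf.pderiv.pderiv : (pderiv a (pderiv b f)).IsHomogeneous _)
  rw [e]
  refine hypF_smul _ _ (by positivity) ?_
  refine hypF_tendsto (l := nhdsWithin (0:ℝ) (Set.Ioi 0))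
    (fun s : ℝ => hessP f (Pi.single o 1 + s • 1)) _ ?_ ?_
  · filter_upwards [self_mem_nhdsWithin] with s hs
    have hs : 0 < s := hs
    refine hl _ fun j => ?_
    have : 0 ≤ (Pi.single o 1 : σ → ℝ) j := by
      by_cases h : j = o <;> simp [Pi.single_apply, h]
    simp only [Pi.add_apply, Pi.smul_apply, smul_eq_mul, Pi.one_apply]
    linarith
  · intro a b
    have : Continuous fun s : ℝ => hessP f (Pi.single o 1 + s • 1) a b :=
      (continuous_eval' _).comp (by fun_prop)
    have h := this.tendsto 0
    simp only [zero_smul, add_zero] at h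
    exact h.mono_left nhdsWithin_le_nhds

/-- Homogeneity, nonnegativity and support-exchange. -/
structure PreP (o : σ) (n : ℕ) (f : MvPolynomial σ ℝ) : Prop where
  hom : f.IsHomogeneous n
  nonneg : ∀ m, 0 ≤ coeff m f
  swap : ∀ (m : σ →₀ ℕ) (j : σ), j ≠ o → coeff (m + Finsupp.single j 1) f ≠ 0 →
    coeff (m + Finsupp.single o 1) f ≠ 0

lemma PreP.pd {o : σ} {n : ℕ} {f : MvPolynomial σ ℝ} (h : PreP o (n + 1) f) (i : σ) :
    PreP o n (pderiv i f) := by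
  refine ⟨by simpa using h.hom.pderiv (i := i), ?_, ?_⟩
  · intro m; rw [coeff_pderiv]; exact mul_nonneg (h.nonneg _) (by positivity)
  · intro m j hj hc
    rw [coeff_pderiv] at hc ⊢
    have h1 := left_ne_zero_of_mul hc
    rw [add_right_comm] at h1 ⊢
    exact mul_ne_zero (h.swap _ j hj h1) (by positivity)

lemma PreP.iter {o : σ} {n : ℕ} (k : ℕ) {f : MvPolynomial σ ℝ} (h : PreP o (n + k) f) :
    PreP o n ((pderiv o)^[k] f) := by
  induction k generalizing f with
  | zero => exact h
  | succ k ih => rw [Function.iterate_succ_apply]; exact ih (h.pd o)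

lemma PreP.eval_nonneg {o : σ} {n : ℕ} {f : MvPolynomial σ ℝ} (h : PreP o n f) (x : σ → ℝ)
    (hx : ∀ i, 0 ≤ x i) : 0 ≤ eval x f := by
  rw [eval_eq]
  exact Finset.sum_nonneg fun m _ => mul_nonneg (h.nonneg m)
    (Finset.prod_nonneg fun i _ => pow_nonneg (hx i) _)

lemma PreP.eval_pos {o : σ} {n : ℕ} {f : MvPolynomial σ ℝ} (h : PreP o n f) (hf : f ≠ 0)
    (x : σ → ℝ) (hx : ∀ i, 0 < x i) : 0 < eval x f := by
  rw [eval_eq]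
  refine Finset.sum_pos (fun m hm => mul_pos ?_ (Finset.prod_pos fun i _ => pow_pos (hx i) _)) ?_
  · exact lt_of_le_of_ne (h.nonneg m) (mem_support_iff.mp hm).symm
  · exact support_nonempty.mpr hf

lemma PreP.pd_ne {o : σ} {n : ℕ} {f : MvPolynomial σ ℝ} (h : PreP o (n + 1) f) (hf : f ≠ 0) :
    pderiv o f ≠ 0 := by
  obtain ⟨m, hm⟩ := ne_zero_iff.mp hf
  have key : ∃ m', coeff (m' + Finsupp.single o 1) f ≠ 0 := by
    have hdeg := h.hom hm
    have : m ≠ 0 := by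
      rintro rfl; simp at hdeg
    obtain ⟨j, hj⟩ := Finsupp.ne_iff.mp this
    have e : m = (m - Finsupp.single j 1) + Finsupp.single j 1 := by
      rw [tsub_add_cancel_of_le]
      rw [Finsupp.single_le_iff]
      simp at hj; omega
    rw [e] at hm
    by_cases hjo : j = o
    · subst hjo; exact ⟨_, hm⟩
    · exact ⟨_, h.swap _ j hjo hm⟩
  obtain ⟨m', hm'⟩ := key
  rw [ne_zero_iff]
  exact ⟨m', by rw [coeff_pderiv]; exact mul_ne_zero hm' (by positivity)⟩

lemma main_lor (o : σ) (d : ℕ) : ∀ (k : ℕ) (f : MvPolynomial σ ℝ), PreP o (d + 2 + k) f →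
    (∀ i, i ≠ o → pderiv i (pderiv i f) = 0) → LorP f → LorP ((pderiv o)^[k] f) := by
  induction d with
  | zero =>
    intro k f hf _ hl
    exact lor_base o k f (by have := hf.hom; rwa [zero_add, add_comm] at this) hl
  | succ d ih =>
    intro k f hf ha hl x hx
    set g := (pderiv o)^[k] f with hg
    have pg : PreP o (d + 1 + 1 + 1) g := PreP.iter k (by convert hf using 1)
    have hG : ∀ i, LorP (pderiv i g) := by
      intro i
      by_cases hi : i = o
      · subst hi
        rw [hg, ← Function.iterate_succ_apply' (pderiv i)]
        exact ih (k + 1) f (by convert hf using 1; ring) ha hl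
      · rw [hg, pd_comm_iter]
        refine ih k _ (PreP.pd (by convert hf using 1; ring) i) ?_ (lor_pderiv f i (ha i hi) hl)
        intro j hj
        rw [pd_comm j i, pd_comm j i, ha j hj]; simp
    refine bochner ((d : ℝ) + 3) (by have : (0:ℝ) ≤ d := by positivity
                                     linarith) (hessP g x)
      (fun i j => by simp only [hessP]; rw [pd_comm])
      (fun k => hessP (pderiv k g) x) (fun i => eval x (pderiv i g)) x hx ?_ ?_ ?_ ?_
      (fun k => hG k x hx) o ?_
    · intro i j
      exact ((pg.pd j).pd i).eval_nonneg x fun i => (hx i).le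
    · intro i
      have := euler_eval _ _ (pg.pd i).hom x
      simp only [hessP]
      push_cast at this
      rw [show ((d:ℝ) + 3 - 1) = d + 2 by ring]
      rw [← this]
      exact Finset.sum_congr rfl fun j _ => by rw [pd_comm, mul_comm]
    · intro i j
      have := euler_eval _ _ ((pg.pd j).pd i).hom x
      simp only [hessP]
      push_cast at this
      rw [show ((d:ℝ) + 3 - 2) = d + 1 by ring, ← this]
      exact Finset.sum_congr rfl fun k _ => by rw [pd_comm k i, pd_comm k j]
    · intro k i
      have := euler_eval _ _ ((pg.pd k).pd i).hom x
      simp only [hessP]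
      push_cast at this
      rw [show ((d:ℝ) + 3 - 2) = d + 1 by ring, ← this]
      exact Finset.sum_congr rfl fun j _ => by rw [pd_comm j i, mul_comm]
    · intro k
      by_cases h0 : pderiv k g = 0
      · left
        constructor
        · intro i j; simp [hessP, h0]
        · intro i; simp [hessP, h0]
      · right
        exact ((pg.pd k).pd o).eval_pos ((pg.pd k).pd_ne h0) x hx

lemma second_deriv_test (φ φ' φ'' : ℝ → ℝ) (h1 : ∀ t, HasDerivAt φ (φ' t) t)
    (h2 : ∀ t, HasDerivAt φ' (φ'' t) t) (h0 : 0 < φ 0) (h3 : φ' 0 = 0)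
    (hm : ∀ᶠ t in nhds 0, φ t * φ (-t) ≤ φ 0 ^ 2) : φ'' 0 ≤ 0 := by
  by_contra hc
  push Not at hc
  have n1 : ∀ t, HasDerivAt (fun t => φ (-t)) (-φ' (-t)) t := fun t => by
    simpa [Function.comp_def] using (h1 (-t)).comp t (hasDerivAt_neg t)
  have n2 : ∀ t, HasDerivAt (fun t => φ' (-t)) (-φ'' (-t)) t := fun t => by
    simpa [Function.comp_def] using (h2 (-t)).comp t (hasDerivAt_neg t)
  have w1 : ∀ t, HasDerivAt (fun t => φ t * φ (-t)) (φ' t * φ (-t) + φ t * -φ' (-t)) t :=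
    fun t => (h1 t).fun_mul (n1 t)
  have w2 : HasDerivAt (fun t => φ' t * φ (-t) + φ t * -φ' (-t)) (2 * φ'' 0 * φ 0) 0 := by
    have := ((h2 0).fun_mul (n1 0)).fun_add ((h1 0).fun_mul (n2 0).fun_neg)
    refine this.congr_deriv ?_
    simp [h3]; ring
  have d1 : deriv (fun t => φ t * φ (-t)) = fun t => φ' t * φ (-t) + φ t * -φ' (-t) :=
    funext fun t => (w1 t).deriv
  have hmin : IsLocalMin (fun t => φ t * φ (-t)) 0 := by
    refine isLocalMin_of_deriv_deriv_pos ?_ ?_ (w1 0).continuousAt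
    · rw [d1, w2.deriv]; positivity
    · rw [d1]; simp [h3]
  have hconst : (fun t => φ t * φ (-t)) =ᶠ[nhds 0] fun _ => φ 0 ^ 2 := by
    filter_upwards [hm, hmin] with t a b
    simp only [neg_zero] at b
    nlinarith
  have e1 := hconst.deriv
  have e2 := e1.deriv_eq
  rw [d1, w2.deriv] at e2
  simp at e2
  rcases e2 with h | h <;> linarith

lemma lor_of_logconcave (f : MvPolynomial σ ℝ) (n : ℕ) (hn : 2 ≤ n) (hf : f.IsHomogeneous n)
    (hpos : ∀ x : σ → ℝ, (∀ i, 0 < x i) → 0 < eval x f)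
    (hlc : ∀ x y : σ → ℝ, (∀ i, 0 < x i) → (∀ i, 0 < y i) →
      eval x f * eval y f ≤ eval ((2:ℝ)⁻¹ • (x + y)) f ^ 2) : LorP f := by
  intro x hx
  refine hypF_of_one _ (fun i j => by simp only [hessP]; rw [pd_comm]) x ?_
  intro v hv
  have hn' : (2:ℝ) ≤ n := by exact_mod_cast hn
  have hv1 : ∑ i, v i * eval x (pderiv i f) = 0 := by
    have e : bilF (hessP f x) v x = ((n:ℝ) - 1) * ∑ i, v i * eval x (pderiv i f) := by
      simp only [bilF, hessP, Finset.mul_sum]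
      refine Finset.sum_congr rfl fun i _ => ?_
      have := euler_eval _ _ (hf.pderiv (i := i)) x
      rw [Nat.cast_sub (by omega)] at this
      rw [← Finset.mul_sum]
      calc _ = v i * ∑ j, x j * eval x (pderiv j (pderiv i f)) := by
            congr 1; exact Finset.sum_congr rfl fun j _ => by rw [pd_comm, mul_comm]
        _ = _ := by rw [this]; push_cast; ring
    rw [e] at hv
    rcases mul_eq_zero.mp hv with h | h
    · linarith
    · exact h
  have := second_deriv_test (fun t => eval (x + t • v) f)
    (fun t => ∑ i, v i * eval (x + t • v) (pderiv i f))
    (fun t => ∑ i, v i * ∑ j, v j * eval (x + t • v) (pderiv j (pderiv i f)))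
    (fun t => hasDerivAt_eval_line f x v t)
    (fun t => HasDerivAt.fun_sum fun i _ => (hasDerivAt_eval_line _ x v t).const_mul (v i))
    (by simpa using hpos x hx) (by simpa using hv1) (by
      have hev : ∀ u : σ → ℝ, ∀ᶠ t in nhds (0:ℝ), ∀ i, 0 < (x + t • u) i := by
        intro u
        rw [Filter.eventually_all]
        intro i
        have : Continuous fun t : ℝ => (x + t • u) i := by
          simp only [Pi.add_apply, Pi.smul_apply]; fun_prop
        refine (this.tendsto 0).eventually (lt_mem_nhds ?_)
        simpa using hx i
      filter_upwards [hev v, hev (-v)] with t h1 h2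
      have := hlc _ _ h1 h2
      rw [show (2:ℝ)⁻¹ • (x + t • v + (x + t • -v)) = x by
        ext i; simp; ring] at this
      simpa [neg_smul, smul_neg] using this)
  simp only [zero_smul, add_zero] at this
  refine le_trans (le_of_eq ?_) this
  simp only [bilF, hessP]
  refine Finset.sum_congr rfl fun i _ => ?_
  congr 1
  exact Finset.sum_congr rfl fun j _ => by rw [pd_comm, mul_comm]

end poly

section mixedpoly
open MvPolynomial
variable {ι : Type*} [Fintype ι] [DecidableEq ι]

/-- exponent vector -/
def expo (n : ℕ) (I : Finset ι) : Option ι →₀ ℕ :=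
  Finsupp.equivFunOnFinite.symm (fun o => o.elim (n - I.card) (fun i => if i ∈ I then 1 else 0))

lemma expo_none (n : ℕ) (I : Finset ι) : expo n I none = n - I.card := rfl
lemma expo_some (n : ℕ) (I : Finset ι) (i : ι) : expo n I (some i) = if i ∈ I then 1 else 0 := rfl

lemma expo_inj (n : ℕ) (I J : Finset ι) (h : expo n I = expo n J) : I = J := by
  ext i
  have := congrArg (fun f => f (some i)) h
  simp only [expo_some] at this
  by_cases h1 : i ∈ I <;> by_cases h2 : i ∈ J <;> simp_all

/-- the volume polynomial -/
def volP (n : ℕ) (c : Finset ι → ℝ) : MvPolynomial (Option ι) ℝ :=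
  ∑ I : Finset ι, monomial (expo n I) (c I)

lemma coeff_volP (n : ℕ) (c : Finset ι → ℝ) (I : Finset ι) : coeff (expo n I) (volP n c) = c I := by
  rw [volP, coeff_sum, Finset.sum_eq_single I]
  · simp
  · intro J _ hJ
    rw [coeff_monomial, if_neg]
    exact fun h => hJ (expo_inj n _ _ h)
  · simp

lemma coeff_volP_ne (n : ℕ) (c : Finset ι → ℝ) (m : Option ι →₀ ℕ) (h : coeff m (volP n c) ≠ 0) :
    ∃ I, expo n I = m ∧ c I ≠ 0 := by
  rw [volP, coeff_sum] at h
  obtain ⟨I, _, hI⟩ := Finset.exists_ne_zero_of_sum_ne_zero h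
  rw [coeff_monomial] at hI
  by_cases h : expo n I = m
  · rw [if_pos h] at hI; exact ⟨I, h, hI⟩
  · rw [if_neg h] at hI; simp at hI

lemma prod_expo (n : ℕ) (I : Finset ι) (x : Option ι → ℝ) :
    ((expo n I).prod fun i e => x i ^ e) = x none ^ (n - I.card) * ∏ i ∈ I, x (some i) := by
  rw [Finsupp.prod_fintype _ _ (fun i => pow_zero _), Fintype.prod_option]
  simp only [expo_none, expo_some]
  congr 1
  rw [← Finset.prod_subset (Finset.subset_univ I)]
  · exact Finset.prod_congr rfl fun i hi => by simp [hi]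
  · intro i _ hi; simp [hi]

lemma eval_volP (n : ℕ) (c : Finset ι → ℝ) (x : Option ι → ℝ) :
    eval x (volP n c) = ∑ I, c I * (x none ^ (n - I.card) * ∏ i ∈ I, x (some i)) := by
  rw [volP, map_sum]
  exact Finset.sum_congr rfl fun I _ => by rw [eval_monomial, prod_expo]

lemma hom_volP (n : ℕ) (c : Finset ι → ℝ) (h0 : ∀ I, n < I.card → c I = 0) :
    (volP n c).IsHomogeneous n := by
  refine IsHomogeneous.sum _ _ _ fun I _ => ?_
  by_cases h : n < I.card
  · rw [h0 I h]; simp [isHomogeneous_zero]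
  · apply isHomogeneous_monomial
    rw [Finsupp.degree_eq_sum, Fintype.sum_option]
    simp only [expo_none, expo_some]
    simp
    omega

lemma preP_volP (n : ℕ) (c : Finset ι → ℝ) (h0 : ∀ I, n < I.card → c I = 0) (hc : ∀ I, 0 ≤ c I)
    (hd : ∀ I, ∀ j ∈ I, c I ≠ 0 → c (I.erase j) ≠ 0) : PreP (none : Option ι) n (volP n c) := by
  refine ⟨hom_volP n c h0, ?_, ?_⟩
  · intro m
    by_contra h
    obtain ⟨I, hI, -⟩ := coeff_volP_ne n c m (by intro h'; rw [h'] at h; simp at h)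
    rw [← hI, coeff_volP] at h
    exact h (hc I)
  · intro m j hj h
    obtain ⟨I, hI, hcI⟩ := coeff_volP_ne n c _ h
    obtain ⟨j, rfl⟩ := Option.ne_none_iff_exists'.1 hj
    have hjI : j ∈ I := by
      by_contra hjI
      have := congrArg (fun f => f (some j)) hI
      simp [expo_some, hjI] at this
    have hcard : I.card ≤ n := by
      by_contra h; exact hcI (h0 I (by omega))
    have : m + Finsupp.single none 1 = expo n (I.erase j) := by
      ext o
      have := congrArg (fun f => f o) hI
      cases o with
      | none =>
        have h1 : 0 < I.card := Finset.card_pos.2 ⟨j, hjI⟩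
        simp [expo_none, Finset.card_erase_of_mem hjI] at this ⊢
        omega
      | some i =>
        simp [expo_some, Finsupp.single_apply] at this ⊢
        by_cases hij : j = i
        · subst hij; simp [hjI] at this ⊢; exact this
        · simp [hij, Ne.symm hij] at this ⊢; exact this.symm
    rw [this, coeff_volP]
    exact hd I j hjI hcI

lemma pd2_volP (n : ℕ) (c : Finset ι → ℝ) (i : Option ι) (hi : i ≠ none) :
    pderiv i (pderiv i (volP n c)) = 0 := by
  obtain ⟨i, rfl⟩ := Option.ne_none_iff_exists'.1 hi
  ext m
  rw [coeff_pderiv, coeff_pderiv, coeff_zero]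
  have : coeff (m + Finsupp.single (some i) 1 + Finsupp.single (some i) 1) (volP n c) = 0 := by
    by_contra h
    obtain ⟨I, hI, -⟩ := coeff_volP_ne n c _ h
    have := congrArg (fun f => f (some i)) hI
    simp [expo_some] at this
    split_ifs at this
    omega
  rw [this]; simp

lemma pd_iter_monomial (o : Option ι) (s : Option ι →₀ ℕ) (a : ℝ) (k : ℕ) :
    (pderiv o)^[k] (monomial s a) = monomial (s - Finsupp.single o k) (a * ((s o).descFactorial k : ℝ)) := by
  induction k with
  | zero => simp
  | succ k ih =>
    rw [Function.iterate_succ_apply', ih, pderiv_monomial]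
    have e : s - Finsupp.single o k - Finsupp.single o 1 = s - Finsupp.single o (k + 1) := by
      rw [tsub_tsub, ← Finsupp.single_add]
    rw [e]
    congr 1
    simp [Nat.descFactorial_succ]; ring

lemma pd_iter_sum (o : Option ι) (k : ℕ) {α : Type*} (s : Finset α) (f : α → MvPolynomial (Option ι) ℝ) :
    (pderiv o)^[k] (∑ a ∈ s, f a) = ∑ a ∈ s, (pderiv o)^[k] (f a) := by
  induction k with
  | zero => simp
  | succ k ih => simp only [Function.iterate_succ_apply', ih, map_sum]

/-- coefficients -/
def bco (n : ℕ) (c : Finset ι → ℝ) (k : ℕ) : ℝ :=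
  ∑ I : Finset ι, if n - I.card = k then c I else 0

/-- boundary point -/
def zpt (ι : Type*) : Option ι → ℝ := fun o => o.elim 0 (fun _ => 1)

lemma eval_pd_iter (n : ℕ) (c : Finset ι → ℝ) (k : ℕ) :
    eval (zpt ι) ((pderiv none)^[k] (volP n c)) = (k.factorial : ℝ) * bco n c k := by
  rw [volP, pd_iter_sum, map_sum, bco, Finset.mul_sum]
  refine Finset.sum_congr rfl fun I _ => ?_
  rw [pd_iter_monomial, eval_monomial, Finsupp.prod_fintype _ _ (fun i => pow_zero _),
    Fintype.prod_option]
  simp only [zpt, Option.elim, one_pow, Finset.prod_const_one, mul_one]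
  simp only [expo_none, Finsupp.tsub_apply, Finsupp.single_eq_same]
  rcases lt_trichotomy (n - I.card) k with h | h | h
  · rw [if_neg h.ne, Nat.descFactorial_of_lt h]; simp
  · rw [if_pos h, h]; simp [Nat.descFactorial_self]; ring
  · rw [if_neg h.ne', zero_pow (by omega)]; simp

lemma bco_nonneg (n : ℕ) (c : Finset ι → ℝ) (hc : ∀ I, 0 ≤ c I) (k : ℕ) : 0 ≤ bco n c k :=
  Finset.sum_nonneg fun I _ => by split_ifs <;> simp [hc]

lemma newton_step (n : ℕ) (c : Finset ι → ℝ) (h0 : ∀ I, n < I.card → c I = 0) (hc : ∀ I, 0 ≤ c I)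
    (hd : ∀ I, ∀ j ∈ I, c I ≠ 0 → c (I.erase j) ≠ 0) (he : c ∅ ≠ 0)
    (hlc : ∀ x y : Option ι → ℝ, (∀ i, 0 < x i) → (∀ i, 0 < y i) →
      eval x (volP n c) * eval y (volP n c) ≤ eval ((2:ℝ)⁻¹ • (x + y)) (volP n c) ^ 2)
    (d k : ℕ) (hk : n = d + 2 + k) :
    ((k:ℝ) + 2) * (d + 2) * (bco n c k * bco n c (k + 2)) ≤ (d + 1) * (k + 1) * bco n c (k + 1) ^ 2 := by
  have hP := preP_volP n c h0 hc hd
  have hne : volP n c ≠ 0 := by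
    intro h
    have := coeff_volP n c ∅
    rw [h] at this; simp at this; exact he this.symm
  have hL : LorP (volP n c) := lor_of_logconcave _ n (by omega) hP.hom
    (fun x hx => hP.eval_pos hne x hx) hlc
  have hL2 := main_lor none d k _ (hk ▸ hP) (fun i hi => pd2_volP n c i hi) hL
  set g := (pderiv (none : Option ι))^[k] (volP n c) with hg
  have hgh : g.IsHomogeneous (d + 2) := hom_iter _ _ _ _ (hk ▸ hP.hom)
  have hH : HypF (hessP g (zpt ι)) := by
    refine hypF_tendsto (l := nhdsWithin (0:ℝ) (Set.Ioi 0))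
      (fun s : ℝ => hessP g (zpt ι + s • fun _ => (1:ℝ))) _ ?_ ?_
    · filter_upwards [self_mem_nhdsWithin] with s hs
      apply hL2
      intro i
      have : (0:ℝ) < s := hs
      cases i <;> simp [zpt] <;> linarith
    · intro a b
      have : Continuous fun s : ℝ => hessP g (zpt ι + s • fun _ => (1:ℝ)) a b := by
        simp only [hessP]
        exact (continuous_eval' _).comp (by fun_prop)
      have := this.tendsto 0
      simp only [zero_smul, add_zero] at this
      exact this.mono_left nhdsWithin_le_nhds
  have e0 := eval_pd_iter n c k
  have e1 := eval_pd_iter n c (k + 1)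
  have e2 := eval_pd_iter n c (k + 2)
  rw [Function.iterate_succ_apply'] at e1
  rw [Function.iterate_succ_apply', Function.iterate_succ_apply'] at e2
  rw [← hg] at e0 e1 e2
  set z := zpt ι
  have E1 := euler_eval g _ hgh z
  have E2 : ∀ i, ∑ j, z j * hessP g z j i = (d + 1 : ℝ) * eval z (pderiv i g) := by
    intro i
    have := euler_eval (pderiv i g) (d + 1) (by simpa using hgh.pderiv (i := i)) z
    push_cast at this
    exact this
  have sym : ∀ i j, hessP g z i j = hessP g z j i := fun i j => by simp only [hessP]; rw [pd_comm]
  have B1 : bilF (hessP g z) z z = (d + 1) * ((d + 2) * (k.factorial * bco n c k)) := by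
    simp only [bilF]
    have : ∀ i, ∑ j, hessP g z i j * z j = (d + 1 : ℝ) * eval z (pderiv i g) := by
      intro i; rw [← E2 i]; exact Finset.sum_congr rfl fun j _ => by rw [sym, mul_comm]
    simp only [this]
    rw [← e0]
    push_cast at E1
    rw [← E1, Finset.mul_sum]
    exact Finset.sum_congr rfl fun i _ => by ring
  have B2 : bilF (hessP g z) (Pi.single none 1) z = (d + 1) * ((k+1).factorial * bco n c (k+1)) := by
    simp only [bilF]
    rw [Finset.sum_eq_single none]
    · rw [← e1, ← E2 none, Pi.single_eq_same, one_mul]; exact Finset.sum_congr rfl fun j _ => by rw [sym, mul_comm]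
    · intro b _ hb; simp [hb]
    · simp
  have B3 : bilF (hessP g z) (Pi.single none 1) (Pi.single none 1) = (k+2).factorial * bco n c (k+2) := by
    simp only [bilF]
    rw [Finset.sum_eq_single none, Finset.sum_eq_single none]
    · rw [← e2]; simp [hessP]
    · intro b _ hb; simp [hb]
    · simp
    · intro b _ hb; simp [hb]
    · simp
  rcases (bco_nonneg n c hc k).eq_or_lt with h | h
  · rw [← h]; simp; positivity
  · have := hH (Pi.single none 1) z (by rw [B1]; positivity)
    rw [B1, B2, B3] at this
    simp only [Nat.factorial_succ] at this
    push_cast at this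
    have hk0 : (0:ℝ) < k.factorial := by positivity
    set f := (k.factorial : ℝ)
    have : 0 < (d + 1 : ℝ) * (k + 1) * f ^ 2 := by positivity
    refine le_of_mul_le_mul_left ?_ this
    nlinarith

lemma seq_logconc (n : ℕ) (a : ℕ → ℝ) (hp : ∀ k ≤ n, 0 < a k)
    (h : ∀ k, k + 2 ≤ n → a k * a (k + 2) ≤ a (k + 1) ^ 2) (j : ℕ) (hj : j + 1 ≤ n) :
    a (j + 1) ^ j * a 0 ≤ a j ^ (j + 1) := by
  induction j with
  | zero => simp
  | succ j ih =>
    have i := ih (by omega)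
    have h1 := h j (by omega)
    have p0 := hp j (by omega)
    have p1 := hp (j+1) (by omega)
    have p2 := hp (j+2) (by omega)
    have q0 := hp 0 (by omega)
    have h2 : (a j * a (j+2)) ^ (j+1) ≤ (a (j+1) ^ 2) ^ (j+1) := by gcongr
    have h3 : 0 < a (j+1) ^ j := by positivity
    have h4 : 0 < a j ^ (j+1) := by positivity
    refine le_of_mul_le_mul_left ?_ (mul_pos h3 h4)
    calc a (j+1) ^ j * a j ^ (j+1) * (a (j+1+1) ^ (j+1) * a 0)
        = (a j * a (j+2)) ^ (j+1) * (a (j+1) ^ j * a 0) := by rw [mul_pow]; ring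
      _ ≤ (a (j+1) ^ 2) ^ (j+1) * a j ^ (j+1) := by gcongr
      _ = _ := by ring

lemma subset_ne (c : Finset ι → ℝ) (hd : ∀ I, ∀ j ∈ I, c I ≠ 0 → c (I.erase j) ≠ 0) (m : ℕ) :
    ∀ I : Finset ι, c I ≠ 0 → m ≤ I.card → ∃ J : Finset ι, c J ≠ 0 ∧ J.card = m := by
  intro I
  induction I using Finset.strongInduction with
  | _ I ih =>
    intro h hm
    rcases hm.eq_or_lt with h1 | h1
    · exact ⟨I, h, h1.symm⟩
    · obtain ⟨j, hj⟩ := Finset.card_pos.1 (by omega : 0 < I.card)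
      exact ih _ (Finset.erase_ssubset hj) (hd I j hj h) (by rw [Finset.card_erase_of_mem hj]; omega)

lemma mixed_core (n : ℕ) (c : Finset ι → ℝ) (h0 : ∀ I, n < I.card → c I = 0) (hc : ∀ I, 0 ≤ c I)
    (hd : ∀ I, ∀ j ∈ I, c I ≠ 0 → c (I.erase j) ≠ 0) (he : c ∅ ≠ 0)
    (hlc : ∀ x y : Option ι → ℝ, (∀ i, 0 < x i) → (∀ i, 0 < y i) →
      eval x (volP n c) * eval y (volP n c) ≤ eval ((2:ℝ)⁻¹ • (x + y)) (volP n c) ^ 2)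
    (hb : 0 < bco n c 0) (j : ℕ) (hj : j + 1 ≤ n) :
    (bco n c (j + 1) / n.choose (j + 1)) ^ j * bco n c 0 ≤ (bco n c j / n.choose j) ^ (j + 1) := by
  have hpos : ∀ k ≤ n, 0 < bco n c k := by
    obtain ⟨I, _, hI⟩ := Finset.exists_ne_zero_of_sum_ne_zero hb.ne'
    have hIc : c I ≠ 0 := by intro h; simp [h] at hI
    have hIn : n - I.card = 0 := by by_contra h; simp [h] at hI
    intro k hk
    obtain ⟨J, hJ, hJc⟩ := subset_ne c hd (n - k) I hIc (by omega)
    refine Finset.sum_pos' (fun I _ => by split_ifs <;> simp [hc]) ⟨J, Finset.mem_univ _, ?_⟩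
    rw [if_pos (by omega)]
    exact lt_of_le_of_ne (hc J) (Ne.symm hJ)
  have hch : ∀ k ≤ n, (0:ℝ) < n.choose k := fun k hk => by exact_mod_cast Nat.choose_pos hk
  have := seq_logconc n (fun k => bco n c k / n.choose k)
    (fun k hk => div_pos (hpos k hk) (hch k hk)) ?_ j hj
  · simpa using this
  · intro k hk
    obtain ⟨d, hdk⟩ : ∃ d, n = d + 2 + k := ⟨n - 2 - k, by omega⟩
    have key := newton_step n c h0 hc hd he hlc d k hdk
    have c1 : (n.choose (k+1) : ℝ) * (k + 1) = n.choose k * (d + 2) := by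
      have := Nat.choose_succ_right_eq n k
      rw [show n - k = d + 2 by omega] at this
      exact_mod_cast this
    have c2 : (n.choose (k+2) : ℝ) * (k + 2) = n.choose (k+1) * (d + 1) := by
      have := Nat.choose_succ_right_eq n (k+1)
      rw [show n - (k+1) = d + 1 by omega] at this
      exact_mod_cast this
    have p0 := hch k (by omega)
    have p1 := hch (k+1) (by omega)
    have p2 := hch (k+2) (by omega)
    rw [div_mul_div_comm, div_pow, div_le_div_iff₀ (by positivity) (by positivity)]
    have e : (n.choose (k+1) : ℝ)^2 * ((d + 1) * (k + 1)) = n.choose k * n.choose (k+2) * ((k+2) * (d+2)) := by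
      linear_combination (n.choose (k+1) : ℝ) * (d+1) * c1 - (n.choose k:ℝ) * (d+2) * c2
    have p3 : (0:ℝ) < (d + 1) * (k + 1) := by positivity
    refine le_of_mul_le_mul_right ?_ p3
    have := mul_le_mul_of_nonneg_left key (mul_pos p0 p2).le
    calc _ = bco n c k * bco n c (k+2) * ((n.choose (k+1) : ℝ)^2 * ((d + 1) * (k + 1))) := by ring
      _ = _ := by rw [e]
      _ = (n.choose k : ℝ) * n.choose (k+2) * (((k:ℝ) + 2) * (d + 2) * (bco n c k * bco n c (k + 2))) := by ring
      _ ≤ _ := this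
      _ = _ := by ring

lemma eval_line_volP (n : ℕ) (c : Finset ι → ℝ) (s : ℝ) :
    ∑ I : Finset ι, c I * s ^ (n - I.card) = ∑ k ∈ Finset.range (n + 1), bco n c k * s ^ k := by
  simp only [bco, Finset.sum_mul]
  rw [Finset.sum_comm]
  refine Finset.sum_congr rfl fun I _ => ?_
  rw [Finset.sum_eq_single (n - I.card)]
  · simp
  · intro b _ hb; simp [Ne.symm hb]
  · intro h; simp at h

end mixedpoly

lemma additive_mono_linear (g : ℝ → ℝ) (hadd : ∀ s t, 0 ≤ s → 0 ≤ t → g (s + t) = g s + g t)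
    (hpos : ∀ t, 0 ≤ t → 0 ≤ g t) (t : ℝ) (ht : 0 ≤ t) : g t = t * g 1 := by
  have h0 : g 0 = 0 := by have := hadd 0 0 le_rfl le_rfl; simp at this; exact this
  have hN : ∀ (N : ℕ) (s : ℝ), 0 ≤ s → g (N * s) = N * g s := by
    intro N s hs
    induction N with
    | zero => simp [h0]
    | succ N ih => push_cast; rw [add_mul, one_mul, hadd _ _ (by positivity) hs, ih]; ring
  have mono : ∀ s t, 0 ≤ s → s ≤ t → g s ≤ g t := by
    intro s t hs hst
    have := hadd s (t - s) hs (by linarith)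
    rw [add_sub_cancel] at this
    have := hpos (t - s) (by linarith)
    linarith
  have h1 := hpos 1 zero_le_one
  have key : ∀ N : ℕ, N * |g t - t * g 1| ≤ g 1 := by
    intro N
    have a1 := Nat.floor_le (show 0 ≤ (N:ℝ) * t by positivity)
    have a2 := Nat.lt_floor_add_one ((N:ℝ) * t)
    set M := ⌊(N:ℝ) * t⌋₊
    have b1 := mono M (N * t) (by positivity) a1
    have b2 := mono (N * t) ((M + 1 : ℕ)) (by positivity) (by push_cast; exact a2.le)
    rw [hN N t ht] at b1 b2
    have c1 := hN M 1 zero_le_one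
    have c2 := hN (M+1) 1 zero_le_one
    rw [mul_one] at c1 c2
    rw [c1] at b1
    rw [c2] at b2
    push_cast at b2
    rw [← Nat.abs_cast N, ← abs_mul, abs_le]
    constructor <;> nlinarith
  by_contra hne
  have hp : 0 < |g t - t * g 1| := abs_pos.2 (sub_ne_zero.2 hne)
  obtain ⟨N, hNN⟩ := exists_nat_gt (g 1 / |g t - t * g 1|)
  rw [div_lt_iff₀ hp] at hNN
  linarith [key N]

/-- vol of shadow is affine -/
lemma vol_affine {n : ℕ} (A : Set (Euc n)) (hA : IsCompact A) (hc : Convex ℝ A) (u : Euc n)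
    (t : ℝ) (ht : 0 ≤ t) :
    (volume (A + (fun r : ℝ => r • u) '' Set.Icc 0 t)).toReal = (volume A).toReal +
      t * ((volume (A + (fun r : ℝ => r • u) '' Set.Icc 0 1)).toReal - (volume A).toReal) := by
  set E : ℝ → Set (Euc n) := fun t => A + (fun r : ℝ => r • u) '' Set.Icc 0 t with hE
  have hEc : ∀ t, IsCompact (E t) := fun t => hA.add (isCompact_Icc.image (by fun_prop))
  have mem : ∀ t x, x ∈ E t ↔ ∃ a ∈ A, ∃ r, (0 ≤ r ∧ r ≤ t) ∧ a + r • u = x := by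
    intro t x
    simp only [hE, Set.mem_add, Set.mem_image, Set.mem_Icc]
    constructor
    · rintro ⟨a, ha, _, ⟨r, hr, rfl⟩, h⟩; exact ⟨a, ha, r, hr, h⟩
    · rintro ⟨a, ha, r, hr, h⟩; exact ⟨a, ha, _, ⟨r, hr, rfl⟩, h⟩
  have hmono : ∀ s t, s ≤ t → E s ⊆ E t := by
    intro s t hst x hx
    rw [mem] at hx ⊢
    obtain ⟨a, ha, r, hr, h⟩ := hx
    exact ⟨a, ha, r, ⟨hr.1, hr.2.trans hst⟩, h⟩
  have hAE : ∀ t, 0 ≤ t → A ⊆ E t := by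
    intro t ht x hx
    rw [mem]; exact ⟨x, hx, 0, ⟨le_rfl, ht⟩, by simp⟩
  have hset : ∀ s t, 0 ≤ s → 0 ≤ t → E (s + t) \ E s = (fun y => s • u + y) '' (E t \ A) := by
    intro s t hs ht
    ext x
    constructor
    · rintro ⟨h1, h2⟩
      rw [mem] at h1 h2
      obtain ⟨a, ha, r, hr, rfl⟩ := h1
      have hrs : s < r := by
        by_contra h
        exact h2 ⟨a, ha, r, ⟨hr.1, by linarith⟩, rfl⟩
      refine ⟨a + (r - s) • u, ⟨?_, ?_⟩, ?_⟩
      · rw [mem]; exact ⟨a, ha, r - s, ⟨by linarith, by linarith⟩, rfl⟩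
      · intro h
        exact h2 ⟨_, h, s, ⟨hs, le_rfl⟩, by module⟩
      · simp only; module
    · rintro ⟨y, ⟨h1, h2⟩, rfl⟩
      rw [mem] at h1
      obtain ⟨a, ha, r, hr, rfl⟩ := h1
      refine ⟨?_, ?_⟩
      · rw [mem]; exact ⟨a, ha, r + s, ⟨by linarith, by linarith⟩, by module⟩
      · intro h
        rw [mem] at h
        obtain ⟨a', ha', r', hr', h⟩ := h
        change a' + r' • u = s • u + (a + r • u) at h
        apply h2
        have h' : a' = a + (r + s - r') • u := by
          have : a' = (s • u + (a + r • u)) - r' • u := by rw [← h]; abel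
          rw [this]; module
        by_cases h0 : r = 0
        · simpa [h0] using ha
        have hp : 0 < r + s - r' := by
          have : 0 < r := lt_of_le_of_ne hr.1 (Ne.symm h0)
          linarith
        have := hc ha ha' (a := 1 - r / (r + s - r')) (b := r / (r + s - r'))
          (by rw [sub_nonneg, div_le_one hp]; linarith) (div_nonneg hr.1 hp.le) (by ring)
        convert this using 1
        rw [h', smul_add, smul_smul, div_mul_cancel₀ _ hp.ne']
        module
  have hfin : ∀ t, volume (E t) ≠ ⊤ := fun t => (hEc t).measure_lt_top.ne
  have hAm := hA.measurableSet
  have hd : ∀ s t, 0 ≤ s → 0 ≤ t → (volume (E (s + t))).toReal - (volume (E s)).toReal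
      = (volume (E t)).toReal - (volume A).toReal := by
    intro s t hs ht
    have h1 : volume (E (s+t) \ E s) = volume (E t \ A) := by
      rw [hset s t hs ht, Set.image_add_left, measure_preimage_add]
    rw [measure_sdiff (hmono _ _ (by linarith)) (hEc s).measurableSet.nullMeasurableSet (hfin s),
      measure_sdiff (hAE t ht) hAm.nullMeasurableSet hA.measure_lt_top.ne] at h1
    rw [← ENNReal.toReal_sub_of_le (measure_mono (hmono _ _ (by linarith))) (hfin _),
      ← ENNReal.toReal_sub_of_le (measure_mono (hAE t ht)) (hfin _), h1]
  have := additive_mono_linear (fun t => (volume (E t)).toReal - (volume A).toReal) ?_ ?_ t ht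
  · simp only [hE] at this ⊢
    linarith
  · intro s t hs ht
    have := hd s t hs ht
    linarith
  · intro t ht
    simp only [sub_nonneg]
    exact ENNReal.toReal_mono (hfin t) (measure_mono (hAE t ht))

section multiaff
variable {ι : Type*} [Fintype ι] [DecidableEq ι]

/-- separately affine -/
def SepAff (F : (ι → ℝ) → ℝ) : Prop := ∀ x : ι → ℝ, 0 ≤ x → ∀ i, ∀ t : ℝ, 0 ≤ t →
  F (Function.update x i t) = F (Function.update x i 0) +
    t * (F (Function.update x i 1) - F (Function.update x i 0))

lemma update_nonneg' (x : ι → ℝ) (hx : 0 ≤ x) (i : ι) (t : ℝ) (ht : 0 ≤ t) :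
    0 ≤ Function.update x i t := by
  intro j
  by_cases h : j = i
  · subst h; simpa using ht
  · simpa [h] using hx j

lemma SepAff.slice {F : (ι → ℝ) → ℝ} (hF : SepAff F) (i : ι) (a : ℝ) (ha : 0 ≤ a) :
    SepAff (fun x => F (Function.update x i a)) := by
  intro x hx j t ht
  by_cases h : j = i
  · subst h; simp
  · simp only [Function.update_comm h]
    exact hF _ (update_nonneg' x hx i a ha) j t ht

lemma SepAff.sub {F G : (ι → ℝ) → ℝ} (hF : SepAff F) (hG : SepAff G) :
    SepAff (fun x => F x - G x) := by
  intro x hx j t ht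
  simp only
  rw [hF x hx j t ht, hG x hx j t ht]; ring

lemma multiaff_aux (S : Finset ι) : ∀ F : (ι → ℝ) → ℝ, SepAff F →
    ∃ c : Finset ι → ℝ, ∀ x : ι → ℝ, 0 ≤ x → (∀ i, i ∉ S → x i = 0) →
      F x = ∑ I ∈ S.powerset, c I * ∏ i ∈ I, x i := by
  induction S using Finset.induction_on with
  | empty =>
    intro F _
    refine ⟨fun _ => F 0, fun x _ h => ?_⟩
    have : x = 0 := funext fun i => h i (by simp)
    simp [this]
  | insert i S hi ih =>
    intro F hF
    obtain ⟨c0, h0⟩ := ih _ (hF.slice i 0 le_rfl)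
    obtain ⟨c1, h1⟩ := ih _ ((hF.slice i 1 zero_le_one).sub (hF.slice i 0 le_rfl))
    refine ⟨fun I => if i ∈ I then c1 (I.erase i) else c0 I, fun x hx hxS => ?_⟩
    have hx' := update_nonneg' x hx i 0 le_rfl
    have hs : ∀ k, k ∉ S → Function.update x i 0 k = 0 := by
      intro k hk
      by_cases h : k = i
      · simp [h]
      · simp only [Function.update_of_ne h]; exact hxS k (by simp [h, hk])
    have e0 := h0 _ hx' hs
    have e1 := h1 _ hx' hs
    simp only [Function.update_idem] at e0 e1
    have e := hF x hx i (x i) (hx i)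
    rw [Function.update_eq_self] at e
    rw [e, e1, e0, Finset.sum_powerset_insert hi, Finset.mul_sum]
    have hp : ∀ I ∈ S.powerset, i ∉ I := fun I hI h => hi (Finset.mem_powerset.1 hI h)
    have hpr : ∀ I ∈ S.powerset, ∏ k ∈ I, Function.update x i 0 k = ∏ k ∈ I, x k := by
      intro I hI
      refine Finset.prod_congr rfl fun k hk => ?_
      rw [Function.update_of_ne]
      rintro rfl; exact hp I hI hk
    congr 1
    · refine Finset.sum_congr rfl fun I hI => ?_
      beta_reduce
      rw [if_neg (hp I hI), hpr I hI]
    · refine Finset.sum_congr rfl fun I hI => ?_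
      beta_reduce
      rw [if_pos (Finset.mem_insert_self i I), Finset.erase_insert (hp I hI), hpr I hI,
        Finset.prod_insert (hp I hI)]
      ring

lemma multiaff (F : (ι → ℝ) → ℝ) (hF : SepAff F) :
    ∃ c : Finset ι → ℝ, ∀ x : ι → ℝ, 0 ≤ x → F x = ∑ I, c I * ∏ i ∈ I, x i := by
  obtain ⟨c, hc⟩ := multiaff_aux Finset.univ F hF
  exact ⟨c, fun x hx => by simpa using hc x hx (by simp)⟩

/-- scaled indicator -/
def ind (I : Finset ι) (s : ℝ) : ι → ℝ := fun i => if i ∈ I then s else 0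

lemma ind_nonneg (I : Finset ι) (s : ℝ) (hs : 0 ≤ s) : 0 ≤ ind I s := by
  intro i; simp only [ind]; split_ifs <;> simp [hs]

lemma prod_ind (I J : Finset ι) (s : ℝ) :
    ∏ i ∈ J, ind I s i = if J ⊆ I then s ^ J.card else 0 := by
  split_ifs with h
  · rw [Finset.prod_congr rfl (g := fun _ => s) (fun i hi => by simp [ind, h hi])]; simp
  · obtain ⟨i, hi, hi'⟩ := Finset.not_subset.1 h
    exact Finset.prod_eq_zero hi (by simp [ind, hi'])

lemma coef_lim (F : (ι → ℝ) → ℝ) (c : Finset ι → ℝ)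
    (hc : ∀ x : ι → ℝ, 0 ≤ x → F x = ∑ I, c I * ∏ i ∈ I, x i) (I : Finset ι) :
    Filter.Tendsto (fun s : ℝ => F (ind I s) / s ^ I.card) Filter.atTop (nhds (c I)) := by
  have : Filter.Tendsto (fun s : ℝ => ∑ J, c J * ((if J ⊆ I then s ^ J.card else 0) / s ^ I.card))
      Filter.atTop (nhds (∑ J, c J * (if J = I then 1 else 0))) := by
    refine tendsto_finsetSum _ fun J _ => Filter.Tendsto.const_mul _ ?_
    by_cases h1 : J ⊆ I
    · by_cases h2 : J = I
      · subst h2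
        simp only [subset_refl, if_true]
        refine (tendsto_const_nhds (x := (1:ℝ))).congr' ?_
        filter_upwards [Filter.eventually_gt_atTop 0] with s hs
        rw [div_self (by positivity)]
      · simp only [h1, if_true, h2, if_false]
        have hlt : J.card < I.card := Finset.card_lt_card (lt_of_le_of_ne h1 h2)
        exact tendsto_pow_div_pow_atTop_zero hlt
    · have h2 : J ≠ I := by rintro rfl; exact h1 subset_rfl
      simp only [h1, h2, if_false, zero_div]
      exact tendsto_const_nhds
  simp only [mul_ite, mul_one, mul_zero, Finset.sum_ite_eq', Finset.mem_univ, if_true] at this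
  refine this.congr' ?_
  filter_upwards [Filter.eventually_ge_atTop 0] with s hs
  rw [hc _ (ind_nonneg I s hs), Finset.sum_div]
  refine Finset.sum_congr rfl fun J _ => ?_
  rw [prod_ind, mul_div_assoc]

end multiaff

section zono
open MvPolynomial
variable {ι : Type*} [Fintype ι] [DecidableEq ι] {n : ℕ}

/-- zonotope -/
def zon (u : ι → Euc n) (x : ι → ℝ) : Set (Euc n) :=
  (fun t : ι → ℝ => ∑ i, t i • u i) '' Set.Icc 0 x

lemma zon_compact (u : ι → Euc n) (x : ι → ℝ) : IsCompact (zon u x) :=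
  isCompact_Icc.image (by fun_prop)

lemma zon_convex (u : ι → Euc n) (x : ι → ℝ) : Convex ℝ (zon u x) := by
  have : IsLinearMap ℝ (fun t : ι → ℝ => ∑ i, t i • u i) :=
    ⟨fun a b => by simp [add_smul, Finset.sum_add_distrib],
     fun a b => by simp [mul_smul, Finset.smul_sum]⟩
  exact (convex_Icc (0 : ι → ℝ) x).is_linear_image this

lemma zon_zero (u : ι → Euc n) : zon u 0 = {0} := by
  simp [zon]

lemma zon_add (u : ι → Euc n) (x y : ι → ℝ) (hx : 0 ≤ x) (hy : 0 ≤ y) :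
    zon u (x + y) = zon u x + zon u y := by
  ext p
  constructor
  · rintro ⟨t, ht, rfl⟩
    refine Set.mem_add.2 ⟨_, ⟨t ⊓ x, ⟨le_inf ht.1 hx, inf_le_right⟩, rfl⟩, _,
      ⟨t - t ⊓ x, ⟨sub_nonneg.2 inf_le_left, ?_⟩, rfl⟩, ?_⟩
    · intro i
      have := ht.2 i
      have := hy i
      simp at *
      rcases le_total (t i) (x i) with h | h
      · rw [inf_eq_left.2 h]; linarith
      · rw [inf_eq_right.2 h]; linarith
    · simp only [← Finset.sum_add_distrib, ← add_smul, Pi.sub_apply, add_sub_cancel]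
  · rintro ⟨_, ⟨s, hs, rfl⟩, _, ⟨t, ht, rfl⟩, rfl⟩
    refine ⟨s + t, ⟨add_nonneg hs.1 ht.1, add_le_add hs.2 ht.2⟩, ?_⟩
    simp [add_smul, Finset.sum_add_distrib]

lemma zon_smul (u : ι → Euc n) (x : ι → ℝ) (s : ℝ) (hs : 0 < s) :
    zon u (s • x) = s • zon u x := by
  ext p
  constructor
  · rintro ⟨t, ht, rfl⟩
    refine Set.mem_smul_set.2 ⟨_, ⟨s⁻¹ • t, ⟨smul_nonneg (by positivity) ht.1, ?_⟩, rfl⟩, ?_⟩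
    · intro i
      have := ht.2 i
      simp at *
      rw [inv_mul_le_iff₀ hs]; exact this
    · simp [Finset.smul_sum, smul_smul, hs.ne']
  · rintro ⟨_, ⟨t, ht, rfl⟩, rfl⟩
    refine ⟨s • t, ⟨smul_nonneg hs.le ht.1, smul_le_smul_of_nonneg_left ht.2 hs.le⟩, ?_⟩
    simp [Finset.smul_sum, smul_smul]

lemma zon_single (u : ι → Euc n) (i : ι) (t : ℝ) :
    zon u (Pi.single i t) = (fun r : ℝ => r • u i) '' Set.Icc 0 t := by
  ext p
  constructor
  · rintro ⟨s, hs, rfl⟩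
    refine ⟨s i, ⟨hs.1 i, by simpa using hs.2 i⟩, ?_⟩
    simp only
    rw [Finset.sum_eq_single i]
    · intro j _ hj
      have h1 := hs.1 j
      have h2 := hs.2 j
      simp [hj] at h1 h2
      rw [le_antisymm h2 h1, zero_smul]
    · simp
  · rintro ⟨r, hr, rfl⟩
    refine ⟨Pi.single i r, ⟨?_, ?_⟩, ?_⟩
    · simpa using hr.1
    · simpa using hr.2
    · simp only
      rw [Finset.sum_eq_single i]
      · simp
      · intro j _ hj; simp [hj]
      · simp

/-- volume functional -/
def vF (K : Set (Euc n)) (u : ι → Euc n) (x : ι → ℝ) : ℝ := (volume (K + zon u x)).toReal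

lemma update_split (x : ι → ℝ) (i : ι) (t : ℝ) :
    Function.update x i t = Function.update x i 0 + Pi.single i t := by
  ext j
  by_cases h : j = i
  · subst h; simp
  · simp [h]

lemma vF_sepAff (K : Set (Euc n)) (hK : IsCompact K) (hc : Convex ℝ K) (u : ι → Euc n) :
    SepAff (vF K u) := by
  intro x hx i t ht
  have h0 := update_nonneg' x hx i 0 le_rfl
  have key : ∀ t : ℝ, 0 ≤ t → vF K u (Function.update x i t) =
      (volume ((K + zon u (Function.update x i 0)) + (fun r : ℝ => r • u i) '' Set.Icc 0 t)).toReal := by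
    intro t ht
    rw [vF, update_split, zon_add u _ _ h0 (by simpa using ht), zon_single, add_assoc]
  rw [key t ht, key 1 zero_le_one]
  exact vol_affine _ (hK.add (zon_compact u _)) (hc.add (zon_convex u _)) (u i) t ht

lemma vol_smul (A : Set (Euc n)) (s : ℝ) (hs : 0 ≤ s) :
    (volume (s • A)).toReal = s ^ n * (volume A).toReal := by
  rw [Measure.addHaar_smul, finrank_euclideanSpace_fin, ENNReal.toReal_mul,
    ENNReal.toReal_ofReal (abs_nonneg _), abs_of_nonneg (by positivity)]

lemma vF_scale (K : Set (Euc n)) (u : ι → Euc n) (x : ι → ℝ) (s : ℝ) (hs : 0 < s) :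
    (volume (s • K + zon u x)).toReal = s ^ n * vF K u (s⁻¹ • x) := by
  rw [vF, ← vol_smul _ s hs.le, smul_add, ← zon_smul u _ s hs, smul_smul, mul_inv_cancel₀ hs.ne', one_smul]

lemma vF_mono_set {A B : Set (Euc n)} (hB : IsCompact B) (h : A ⊆ B) :
    (volume A).toReal ≤ (volume B).toReal :=
  ENNReal.toReal_mono hB.measure_lt_top.ne (measure_mono h)

lemma zono_ineq (K : Set (Euc n)) (hK : IsCompact K) (hc : Convex ℝ K) (r : ℝ) (hr : 0 < r)
    (hrK : closedBall 0 r ⊆ K) (u : ι → Euc n) :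
    ∃ b : ℕ → ℝ, (∀ k, 0 ≤ b k) ∧ (∀ s : ℝ, 0 < s → (volume (s • K + zon u 1)).toReal =
        ∑ k ∈ Finset.range (n + 1), b k * s ^ k) ∧
      ∀ j, j + 1 ≤ n → 1 ≤ j →
        (b (j + 1) / n.choose (j + 1)) ^ j * b 0 ≤ (b j / n.choose j) ^ (j + 1) := by
  obtain ⟨c, hcF⟩ := multiaff (vF K u) (vF_sepAff K hK hc u)
  have h0K : (0 : Euc n) ∈ K := hrK (by simp [hr.le])
  have lim := coef_lim _ _ hcF
  have hcc : ∀ x, IsCompact (K + zon u x) := fun x => hK.add (zon_compact u x)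
  have hc0 : ∀ I, 0 ≤ c I := by
    intro I
    refine ge_of_tendsto (lim I) ?_
    filter_upwards [Filter.eventually_ge_atTop 0] with s hs
    exact div_nonneg ENNReal.toReal_nonneg (by positivity)
  have hind : ∀ (I : Finset ι) (s t : ℝ), ind I (s * t) = s • ind I t := by
    intro I s t; ext i; simp [ind]
  have hcn : ∀ I, n < I.card → c I = 0 := by
    intro I hI
    refine le_antisymm ?_ (hc0 I)
    have l2 : Filter.Tendsto (fun s : ℝ => s ^ n / s ^ I.card * vF K u (ind I 1)) Filter.atTop (nhds 0) := by
      simpa using (tendsto_pow_div_pow_atTop_zero (𝕜 := ℝ) hI).mul_const (vF K u (ind I 1))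
    refine le_of_tendsto_of_tendsto (lim I) l2 ?_
    filter_upwards [Filter.eventually_ge_atTop 1] with s hs
    have hs0 : 0 < s := by linarith
    rw [div_mul_eq_mul_div]
    gcongr
    have := vF_scale K u (ind I s) s hs0
    rw [← hind, inv_mul_cancel₀ hs0.ne'] at this
    rw [← this, vF]
    refine vF_mono_set ((hK.smul s).add (zon_compact u _)) (Set.add_subset_add_right ?_)
    intro x hx
    rw [Set.mem_smul_set_iff_inv_smul_mem₀ hs0.ne']
    exact hc.smul_mem_of_zero_mem h0K hx ⟨by positivity, inv_le_one_of_one_le₀ hs⟩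
  have hce : c ∅ ≠ 0 := by
    have := hcF 0 le_rfl
    rw [Finset.sum_eq_single ∅] at this
    · simp at this
      rw [← this, vF, zon_zero, Set.singleton_zero, add_zero]
      refine (ENNReal.toReal_pos ?_ hK.measure_lt_top.ne).ne'
      exact ((measure_closedBall_pos volume (0 : Euc n) hr).trans_le (measure_mono hrK)).ne'
    · intro I _ hI
      obtain ⟨i, hi⟩ := Finset.nonempty_iff_ne_empty.2 hI
      rw [Finset.prod_eq_zero hi (by simp), mul_zero]
    · simp
  have hd : ∀ I, ∀ j ∈ I, c I ≠ 0 → c (I.erase j) ≠ 0 := by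
    intro I j hj hcI hz
    obtain ⟨ε, hε, hεK⟩ : ∃ ε : ℝ, 0 < ε ∧ ε * ‖u j‖ ≤ r := by
      refine ⟨r / (‖u j‖ + 1), by positivity, ?_⟩
      rw [div_mul_eq_mul_div, div_le_iff₀ (by positivity)]
      nlinarith [norm_nonneg (u j)]
    have l2 : Filter.Tendsto (fun s : ℝ => 2 ^ n * (vF K u (ind (I.erase j) (s/2)) / (s/2) ^ (I.erase j).card)
        / 2 ^ (I.erase j).card) Filter.atTop (nhds 0) := by
      have := ((((lim (I.erase j)).comp (Filter.tendsto_id.atTop_div_const (by norm_num : (0:ℝ) < 2)))).const_mul (2^n)).div_const (2 ^ (I.erase j).card)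
      rw [hz] at this
      simpa using this
    have : c I * ε ≤ 0 := by
      refine ge_of_tendsto l2 ?_
      filter_upwards [Filter.eventually_gt_atTop 0] with s hs
      rw [div_pow]
      rw [show (2:ℝ) ^ n * (vF K u (ind (I.erase j) (s / 2)) / (s ^ (I.erase j).card / 2 ^ (I.erase j).card)) / 2 ^ (I.erase j).card
        = 2 ^ n * vF K u (ind (I.erase j) (s / 2)) / s ^ (I.erase j).card by field_simp]
      rw [le_div_iff₀ (by positivity)]
      have e1 := vF_scale K u (ind (I.erase j) s) 2 (by norm_num)
      rw [← hind, inv_mul_eq_div] at e1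
      rw [← e1]
      have hy : 0 ≤ ind (I.erase j) s + Pi.single j ε := add_nonneg (ind_nonneg _ _ hs.le) (by simpa using hε.le)
      have e2 := hcF _ hy
      have e3 : c I * ε * s ^ (I.erase j).card ≤ vF K u (ind (I.erase j) s + Pi.single j ε) := by
        rw [e2]
        set y : ι → ℝ := ind (I.erase j) s + Pi.single j ε with hydef
        have : c I * ε * s ^ (I.erase j).card = c I * ∏ i ∈ I, y i := by
          rw [← Finset.mul_prod_erase I _ hj]
          rw [Finset.prod_congr rfl (g := fun _ => s)]
          · simp [hydef, ind]; ring
          · intro i hi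
            have : i ≠ j := Finset.ne_of_mem_erase hi
            simp [hydef, ind, this, Finset.mem_of_mem_erase hi]
        rw [this]
        exact Finset.single_le_sum (f := fun I => c I * ∏ i ∈ I, y i)
          (fun J _ => mul_nonneg (hc0 J) (Finset.prod_nonneg fun i _ => hy i)) (Finset.mem_univ I)
      refine e3.trans ?_
      rw [vF]
      refine vF_mono_set ((hK.smul 2).add (zon_compact u _)) ?_
      rw [zon_add u _ _ (ind_nonneg _ _ hs.le) (by simpa using hε.le), zon_single, add_comm (zon u _), ← add_assoc]
      refine Set.add_subset_add_right ?_
      rintro _ ⟨a, ha, _, ⟨t, ht, rfl⟩, rfl⟩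
      rw [Set.mem_smul_set_iff_inv_smul_mem₀ (by norm_num)]
      have hb : t • u j ∈ K := hrK (by
        rw [mem_closedBall_zero_iff, norm_smul, Real.norm_of_nonneg ht.1]
        exact (mul_le_mul_of_nonneg_right ht.2 (norm_nonneg _)).trans hεK)
      have := hc ha hb (a := 2⁻¹) (b := 2⁻¹) (by norm_num) (by norm_num) (by norm_num)
      simpa [smul_add] using this
    have h1 : 0 < c I := lt_of_le_of_ne (hc0 I) (Ne.symm hcI)
    nlinarith [mul_pos h1 hε]
  have hev : ∀ (s : ℝ) (x : ι → ℝ), 0 < s → 0 ≤ x → (volume (s • K + zon u x)).toReal =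
      ∑ I, c I * (s ^ (n - I.card) * ∏ i ∈ I, x i) := by
    intro s x hs hx
    rw [vF_scale K u x s hs, hcF _ (smul_nonneg (by positivity) hx), Finset.mul_sum]
    refine Finset.sum_congr rfl fun I _ => ?_
    by_cases h : n < I.card
    · simp [hcn I h]
    · simp only [Pi.smul_apply, smul_eq_mul, Finset.prod_mul_distrib, Finset.prod_const]
      rw [pow_sub₀ _ hs.ne' (by omega), inv_pow]; ring
  refine ⟨bco n c, bco_nonneg n c hc0, ?_, ?_⟩
  · intro s hs
    rw [hev s 1 hs zero_le_one, ← eval_line_volP]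
    simp
  · intro j hj hj1
    rcases (bco_nonneg n c hc0 0).eq_or_lt with hb | hb
    · rw [← hb, mul_zero]; exact pow_nonneg (div_nonneg (bco_nonneg n c hc0 _) (by positivity)) _
    refine mixed_core n c hcn hc0 hd hce ?_ hb j hj
    intro x y hx hy
    have hp : ∀ x : Option ι → ℝ, (∀ i, 0 < x i) → eval x (volP n c) =
        (volume (x none • K + zon u (fun i => x (some i)))).toReal := by
      intro x hx
      rw [eval_volP, hev _ _ (hx none) (fun i => (hx _).le)]
    have hm : ∀ i, 0 < ((2:ℝ)⁻¹ • (x + y)) i := by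
      intro i; have := hx i; have := hy i; simp; linarith
    rw [hp x hx, hp y hy, hp _ hm, ← ENNReal.toReal_mul, ← ENNReal.toReal_pow]
    have hcx : ∀ x : Option ι → ℝ, IsCompact (x none • K + zon u (fun i => x (some i))) :=
      fun x => (hK.smul _).add (zon_compact u _)
    refine ENNReal.toReal_mono (ENNReal.pow_ne_top (hcx _).measure_lt_top.ne) ?_
    refine bmE n _ _ _ (hcx _) (hcx _) (hcx _) ?_
    rintro _ ⟨_, ⟨a, ha, rfl⟩, z, hz, rfl⟩ _ ⟨_, ⟨b, hb, rfl⟩, w, hw, rfl⟩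
    have e1 : (fun i => ((2:ℝ)⁻¹ • (x + y)) (some i)) = (2:ℝ)⁻¹ • ((fun i => x (some i)) + fun i => y (some i)) := by
      ext i; simp
    rw [e1, zon_smul u _ _ (by norm_num), zon_add u _ _ (fun i => (hx _).le) (fun i => (hy _).le)]
    refine Set.mem_add.2 ⟨(2:ℝ)⁻¹ • (x none • a + y none • b), ?_, (2:ℝ)⁻¹ • (z + w), ?_, ?_⟩
    · have := hx none
      have := hy none
      have hs : 0 < x none + y none := by linarith
      refine ⟨(x none / (x none + y none)) • a + (y none / (x none + y none)) • b,
        hc ha hb (by positivity) (by positivity) (by rw [← add_div, div_self hs.ne']), ?_⟩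
      simp only [Pi.smul_apply, Pi.add_apply, smul_eq_mul, smul_add, smul_smul]
      congr 2 <;> field_simp
    · exact Set.smul_mem_smul_set (Set.add_mem_add hz hw)
    · simp only; module

end zono

/-- positive part of the inner product -/
def pip {n : ℕ} (x u : Euc n) : ℝ := max (⟪x, u⟫) 0

lemma pip_cont {n : ℕ} : Continuous (fun p : Euc n × Euc n => pip p.1 p.2) := by
  unfold pip; fun_prop

lemma pip_smul {n : ℕ} (x u : Euc n) (s : ℝ) (hs : 0 ≤ s) : pip x (s • u) = s * pip x u := by
  simp only [pip, inner_smul_right]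
  rw [mul_max_of_nonneg _ _ hs, mul_zero]

lemma pip_smul_left {n : ℕ} (x u : Euc n) (s : ℝ) (hs : 0 ≤ s) : pip (s • x) u = s * pip x u := by
  simp only [pip, real_inner_smul_left]
  rw [mul_max_of_nonneg _ _ hs, mul_zero]

lemma pip_int_rot {n : ℕ} (x y : Euc n) (h : ‖x‖ = ‖y‖) :
    ∫ u in closedBall (0 : Euc n) 1, pip x u = ∫ u in closedBall (0 : Euc n) 1, pip y u := by
  set R := (ℝ ∙ (x - y))ᗮ.reflection with hR
  have hRx : R x = y := Submodule.reflection_sub h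
  have hm : MeasurePreserving R volume volume := R.measurePreserving
  have := hm.setIntegral_preimage_emb R.toHomeomorph.measurableEmbedding (fun u => pip y u) (closedBall 0 1)
  rw [← this]
  have e1 : R ⁻¹' closedBall 0 1 = closedBall 0 1 := by
    ext u; simp
  rw [e1]
  refine integral_congr_ae (Filter.Eventually.of_forall fun u => ?_)
  simp only [pip]
  rw [← hRx, R.inner_map_map]

lemma pip_int_pos {n : ℕ} (x : Euc n) (h : ‖x‖ = 1) :
    0 < ∫ u in closedBall (0 : Euc n) 1, pip x u := by
  have hc : Continuous fun u => pip x u := pip_cont.comp (by fun_prop : Continuous fun u : Euc n => (x, u))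
  rw [setIntegral_pos_iff_support_of_nonneg_ae]
  · refine (measure_ball_pos volume ((2:ℝ)⁻¹ • x) (show (0:ℝ) < 4⁻¹ by norm_num)).trans_le (measure_mono ?_)
    intro u hu
    rw [mem_ball_iff_norm] at hu
    have hn : ‖(2:ℝ)⁻¹ • x‖ = 2⁻¹ := by rw [norm_smul, h]; norm_num
    refine ⟨?_, ?_⟩
    · have e : ⟪x, u⟫ = 2⁻¹ + ⟪x, u - (2:ℝ)⁻¹ • x⟫ := by
        rw [inner_sub_right, inner_smul_right, real_inner_self_eq_norm_sq, h]; ring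
      have := abs_real_inner_le_norm x (u - (2:ℝ)⁻¹ • x)
      rw [h, one_mul] at this
      have := (abs_le.1 (this.trans hu.le)).1
      have hp : 0 < ⟪x, u⟫ := by rw [e]; linarith
      simp only [Function.mem_support, pip]
      rw [max_eq_left hp.le]; exact hp.ne'
    · rw [mem_closedBall_zero_iff]
      have := norm_add_le (u - (2:ℝ)⁻¹ • x) ((2:ℝ)⁻¹ • x)
      rw [sub_add_cancel, hn] at this
      linarith
  · exact Filter.Eventually.of_forall fun u => le_max_right _ _
  · exact hc.continuousOn.integrableOn_compact (isCompact_closedBall _ _)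

lemma finite_approx {n : ℕ} (hn : 1 ≤ n) : ∃ c : ℝ, 0 < c ∧ ∀ ε > 0, ∃ (ι : Type) (_ : Fintype ι)
    (w : ι → ℝ) (u : ι → Euc n), (∀ i, 0 ≤ w i) ∧
      ∀ x : Euc n, ‖x‖ = 1 → |∑ i, w i * pip x (u i) - c| ≤ ε := by
  set X := sphere (0 : Euc n) 1
  set B := closedBall (0 : Euc n) 1
  let G : C(Euc n × X, ℝ) := ⟨fun p => pip (p.2 : Euc n) p.1, pip_cont.comp (by fun_prop : Continuous fun p : Euc n × X => ((p.2 : Euc n), p.1))⟩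
  let f : C(Euc n, C(X, ℝ)) := G.curry
  have hf : ∀ u x, f u x = pip x u := fun u x => rfl
  have hIntg : IntegrableOn f B volume := f.continuous.continuousOn.integrableOn_compact (isCompact_closedBall _ _)
  obtain ⟨e, he⟩ : ∃ e : Euc n, ‖e‖ = 1 := ⟨EuclideanSpace.single ⟨0, hn⟩ 1, by simp⟩
  have hB0 : volume B ≠ 0 := (measure_closedBall_pos _ _ one_pos).ne'
  have hBt : volume B ≠ ⊤ := (isCompact_closedBall _ _).measure_lt_top.ne
  set c : ℝ := (volume B).toReal⁻¹ * ∫ u in B, pip e u with hc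
  have hmem := Convex.set_average_mem (convex_convexHull ℝ (Set.range f)).closure isClosed_closure hB0 hBt
    (Filter.Eventually.of_forall fun u => subset_closure (subset_convexHull ℝ _ (Set.mem_range_self u))) hIntg
  have hval : ∀ x : X, (⨍ u in B, f u ∂volume) x = c := by
    intro x
    rw [setAverage_eq]
    simp only [ContinuousMap.smul_apply, smul_eq_mul, hc]
    have h1 : (∫ u in B, f u) x = ∫ u in B, f u x := by
      have := (ContinuousMap.evalCLM ℝ x).integral_comp_comm hIntg
      exact this.symm
    rw [h1]
    simp only [hf]
    rw [pip_int_rot (x : Euc n) e (by rw [he]; exact mem_sphere_zero_iff_norm.1 x.2)]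
    rfl
  refine ⟨c, mul_pos (inv_pos.2 (ENNReal.toReal_pos hB0 hBt)) (pip_int_pos e he), ?_⟩
  intro ε hε
  obtain ⟨g, hg, hgd⟩ := Metric.mem_closure_iff.1 hmem ε hε
  rw [mem_convexHull_iff_exists_fintype] at hg
  obtain ⟨ι, hι, w, z, hw, _, hz, hsum⟩ := hg
  choose u hu using hz
  refine ⟨ι, hι, w, u, hw, fun x hx => ?_⟩
  have hx' : x ∈ X := by simpa [X] using hx
  have h1 := ContinuousMap.dist_apply_le_dist (f := ⨍ u in B, f u ∂volume) (g := g) (⟨x, hx'⟩ : X)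
  rw [hval] at h1
  have h2 : g ⟨x, hx'⟩ = ∑ i, w i * pip x (u i) := by
    rw [← hsum]
    simp only [ContinuousMap.sum_apply, ContinuousMap.smul_apply, smul_eq_mul, ← hu, hf]
  rw [h2, dist_comm, Real.dist_eq] at h1
  exact h1.trans hgd.le

lemma ball_approx {n : ℕ} (hn : 1 ≤ n) (ε : ℝ) (hε : 0 < ε) : ∃ (ι : Type) (_ : Fintype ι)
    (u : ι → Euc n), closedBall 0 (1 - ε) ⊆ zon u 1 ∧ zon u 1 ⊆ closedBall 0 (1 + ε) := by
  classical
  obtain ⟨c, hc, h⟩ := finite_approx hn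
  obtain ⟨ι, hι, w, u, hw, H⟩ := h (c * ε) (by positivity)
  have H2 : ∀ x : Euc n, (1 - ε) * ‖x‖ ≤ ∑ i, pip x ((w i / c) • u i) ∧
      ∑ i, pip x ((w i / c) • u i) ≤ (1 + ε) * ‖x‖ := by
    intro x
    by_cases hx : x = 0
    · simp [hx, pip]
    have hxn : 0 < ‖x‖ := norm_pos_iff.2 hx
    have h1 := H (‖x‖⁻¹ • x) (by rw [norm_smul, norm_inv, norm_norm, inv_mul_cancel₀ hxn.ne'])
    have e : ∑ i, pip x ((w i / c) • u i) = ‖x‖ / c * ∑ i, w i * pip (‖x‖⁻¹ • x) (u i) := by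
      rw [Finset.mul_sum]
      refine Finset.sum_congr rfl fun i _ => ?_
      rw [pip_smul _ _ _ (div_nonneg (hw i) hc.le), pip_smul_left _ _ _ (by positivity)]
      field_simp
    rw [e]
    rw [abs_le] at h1
    set S := ∑ i, w i * pip (‖x‖⁻¹ • x) (u i)
    rw [div_mul_eq_mul_div, le_div_iff₀ hc, div_le_iff₀ hc]
    constructor <;> nlinarith
  refine ⟨ι, hι, fun i => (w i / c) • u i, ?_, ?_⟩
  · set v := fun i => (w i / c) • u i with hv
    intro p hp
    rw [mem_closedBall_zero_iff] at hp
    by_contra hpZ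
    obtain ⟨f, a, hfa, hap⟩ := geometric_hahn_banach_closed_point (zon_convex v 1) (zon_compact v 1).isClosed hpZ
    set y := (InnerProductSpace.toDual ℝ (Euc n)).symm f with hy
    have hfy : ∀ z, f z = ⟪y, z⟫ := fun z => by rw [hy, InnerProductSpace.toDual_symm_apply]
    have hz := hfa (∑ i, (if 0 < ⟪y, v i⟫ then (1:ℝ) else 0) • v i) ⟨fun i => if 0 < ⟪y, v i⟫ then 1 else 0,
      ⟨fun i => by simp only [Pi.zero_apply]; split_ifs <;> norm_num, fun i => by simp only [Pi.one_apply]; split_ifs <;> norm_num⟩, rfl⟩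
    rw [hfy, inner_sum] at hz
    have e : ∑ i, ⟪y, (if 0 < ⟪y, v i⟫ then (1:ℝ) else 0) • v i⟫ = ∑ i, pip y (v i) := by
      refine Finset.sum_congr rfl fun i _ => ?_
      simp only [pip]
      split_ifs with h
      · rw [one_smul, max_eq_left h.le]
      · rw [zero_smul, inner_zero_right, max_eq_right (not_lt.1 h)]
    rw [e] at hz
    rw [hfy] at hap
    have h1 := (H2 y).1
    have h2 := real_inner_le_norm y p
    have h3 := mul_le_mul_of_nonneg_left hp (norm_nonneg y)
    linarith
  · rintro _ ⟨t, ht, rfl⟩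
    set v := fun i => (w i / c) • u i with hv
    simp only
    set z := ∑ i, t i • v i with hz
    rw [mem_closedBall_zero_iff]
    by_contra hlt
    push Not at hlt
    have h1 := (H2 z).2
    have h2 : ‖z‖ ^ 2 ≤ ∑ i, pip z (v i) := by
      rw [← real_inner_self_eq_norm_sq]
      conv_lhs => rw [hz]
      rw [← hz, inner_sum]
      refine Finset.sum_le_sum fun i _ => ?_
      rw [inner_smul_right]
      have a1 := ht.1 i
      have a2 := ht.2 i
      simp at a1 a2
      simp only [pip]
      calc t i * ⟪z, v i⟫ ≤ t i * max (⟪z, v i⟫) 0 := by gcongr; exact le_max_left _ _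
        _ ≤ 1 * max (⟪z, v i⟫) 0 := by gcongr
        _ = _ := one_mul _
    have : 0 < ‖z‖ := by linarith
    nlinarith

lemma coef_conv (n : ℕ) (b : ℕ → ℕ → ℝ) (β : ℕ → ℝ)
    (h : ∀ s : ℝ, 0 < s → Filter.Tendsto (fun m => ∑ k ∈ Finset.range (n + 1), b m k * s ^ k) Filter.atTop
      (nhds (∑ k ∈ Finset.range (n + 1), β k * s ^ k))) (k : ℕ) (hk : k ≤ n) :
    Filter.Tendsto (fun m => b m k) Filter.atTop (nhds (β k)) := by
  let P : (ℕ → ℝ) → Polynomial ℝ := fun a => ∑ k ∈ Finset.range (n + 1), Polynomial.C (a k) * Polynomial.X ^ k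
  have hdeg : ∀ a, (P a).degree < (Finset.univ : Finset (Fin (n + 1))).card := by
    intro a
    rw [Finset.card_univ, Fintype.card_fin]
    refine (Polynomial.degree_sum_le _ _).trans_lt ?_
    rw [Finset.sup_lt_iff (by exact_mod_cast WithBot.bot_lt_coe _)]
    intro i hi
    refine (Polynomial.degree_C_mul_X_pow_le _ _).trans_lt ?_
    exact_mod_cast Finset.mem_range.1 hi
  have hev : ∀ a s, (P a).eval s = ∑ k ∈ Finset.range (n + 1), a k * s ^ k := by
    intro a s; simp [P, Polynomial.eval_finsetSum]
  have hco : ∀ a, (P a).coeff k = a k := by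
    intro a
    simp only [P, Polynomial.finsetSum_coeff, Polynomial.coeff_C_mul_X_pow]
    rw [Finset.sum_ite_eq]
    simp; omega
  let v : Fin (n + 1) → ℝ := fun i => (i : ℝ) + 1
  have hv : Set.InjOn v (Finset.univ : Finset (Fin (n + 1))) := by
    intro i _ j _ hij
    simp only [v] at hij
    ext
    have : ((i : ℕ) : ℝ) = (j : ℕ) := by linarith
    exact_mod_cast this
  have hL : ∀ a, a k = ∑ i : Fin (n + 1), (P a).eval (v i) * (Lagrange.basis Finset.univ v i).coeff k := by
    intro a
    have := Lagrange.eq_interpolate hv (hdeg a)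
    conv_lhs => rw [← hco a, this]
    rw [Lagrange.interpolate_apply, Polynomial.finsetSum_coeff]
    exact Finset.sum_congr rfl fun i _ => by rw [Polynomial.coeff_C_mul]
  rw [hL β]
  simp_rw [hL (b _)]
  refine tendsto_finsetSum _ fun i _ => Filter.Tendsto.mul_const _ ?_
  simp only [hev]
  exact h _ (by simp only [v]; positivity)

lemma smul_ball_sub {n : ℕ} (a : ℝ) (ha : 0 ≤ a) : closedBall (0 : Euc n) a = a • closedBall (0 : Euc n) 1 := by
  rw [_root_.smul_closedBall _ _ zero_le_one, smul_zero, mul_one, Real.norm_of_nonneg ha]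

lemma kappa_closed (n : ℕ) : (volume (closedBall (0 : Euc n) 1)).toReal = kappa n := by
  rw [kappa, Measure.addHaar_unitClosedBall_eq_addHaar_unitBall]

lemma kappa_pos (n : ℕ) : 0 < kappa n :=
  ENNReal.toReal_pos (measure_ball_pos _ _ one_pos).ne' measure_ball_lt_top.ne

lemma limit_ineq {n : ℕ} (hn : 1 ≤ n) (K : Set (Euc n)) (hK : IsCompact K) (hc : Convex ℝ K) (r : ℝ) (hr : 0 < r)
    (hrK : closedBall 0 r ⊆ K) (β : ℕ → ℝ)
    (hβ : ∀ s : ℝ, 0 < s → (volume (s • K + closedBall (0 : Euc n) 1)).toReal =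
      ∑ k ∈ Finset.range (n + 1), β k * s ^ k) (j : ℕ) (hj1 : 1 ≤ j) (hjn : j + 1 ≤ n) :
    0 ≤ β j ∧ 0 ≤ β (j + 1) ∧
    (β (j + 1) / n.choose (j + 1)) ^ j * kappa n ≤ (β j / n.choose j) ^ (j + 1) := by
  classical
  have h0K : (0 : Euc n) ∈ K := hrK (by simp [hr.le])
  have hKc : ∀ s : ℝ, IsCompact (s • K + closedBall (0 : Euc n) 1) :=
    fun s => (hK.smul s).add (isCompact_closedBall _ _)
  have hscale : ∀ (s t : ℝ), 0 < s → s ≤ t → s • K ⊆ t • K := by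
    rintro s t hs hst _ ⟨x, hx, rfl⟩
    have ht : 0 < t := by linarith
    refine ⟨(s / t) • x, hc.smul_mem_of_zero_mem h0K hx ⟨by positivity, (div_le_one ht).2 hst⟩, ?_⟩
    simp only [smul_smul]; congr 1; field_simp
  have hε : ∀ m : ℕ, (0:ℝ) < 1 / ((m:ℝ) + 2) := fun m => by positivity
  choose ι hι u hu1 hu2 using fun m : ℕ => ball_approx hn _ (hε m)
  choose b hb0 hb1 hb2 using fun m : ℕ => zono_ineq K hK hc r hr hrK (u m)
  have hεl : Filter.Tendsto (fun m : ℕ => 1 / ((m:ℝ) + 2)) Filter.atTop (nhds 0) := by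
    have := (tendsto_one_div_add_atTop_nhds_zero_nat (𝕜 := ℝ)).comp (Filter.tendsto_add_atTop_nat 1)
    refine this.congr fun m => ?_
    simp; ring
  have hconv : ∀ k ≤ n, Filter.Tendsto (fun m => b m k) Filter.atTop (nhds (β k)) := by
    refine coef_conv n b β fun s hs => ?_
    rw [← hβ s hs]
    set f := (volume (s • K + closedBall (0 : Euc n) 1)).toReal
    have l1 : Filter.Tendsto (fun m : ℕ => (1 - 1 / ((m:ℝ) + 2)) ^ n * f) Filter.atTop (nhds f) := by
      simpa using ((hεl.const_sub 1).pow n).mul_const f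
    have l2 : Filter.Tendsto (fun m : ℕ => (1 + 1 / ((m:ℝ) + 2)) ^ n * f) Filter.atTop (nhds f) := by
      simpa using ((hεl.const_add 1).pow n).mul_const f
    refine tendsto_of_tendsto_of_tendsto_of_le_of_le l1 l2 (fun m => ?_) (fun m => ?_)
    · simp only
      have h1 : 1 / ((m:ℝ) + 2) < 1 := by rw [div_lt_one (by positivity)]; have : (0:ℝ) ≤ m := by positivity
                                          linarith
      have h2 := hε m
      set e := 1 / ((m:ℝ) + 2)
      rw [← hb1 m s hs, ← vol_smul _ _ (by linarith)]
      refine vF_mono_set ((hK.smul s).add (zon_compact _ _)) ?_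
      rw [smul_add, ← smul_ball_sub _ (by linarith), smul_smul]
      exact Set.add_subset_add (hscale _ _ (mul_pos (by linarith) hs) (by nlinarith)) (hu1 m)
    · simp only
      have h2 := hε m
      set e := 1 / ((m:ℝ) + 2)
      rw [← hb1 m s hs, ← vol_smul _ _ (by linarith)]
      refine vF_mono_set ((hKc s).smul _) ?_
      rw [smul_add, ← smul_ball_sub _ (by linarith), smul_smul]
      exact Set.add_subset_add (hscale _ _ hs (by nlinarith)) (hu2 m)
  have hβ0 : β 0 = kappa n := by
    obtain ⟨R, hR⟩ := hK.isBounded.subset_closedBall (0 : Euc n)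
    have hR0 : 0 ≤ R := by have := hR h0K; simpa using this
    have l0 : Filter.Tendsto (fun s : ℝ => ∑ k ∈ Finset.range (n + 1), β k * s ^ k) (nhdsWithin 0 (Set.Ioi 0)) (nhds (β 0)) := by
      have hcont : Continuous (fun s : ℝ => ∑ k ∈ Finset.range (n + 1), β k * s ^ k) := by fun_prop
      have := hcont.tendsto 0
      rw [Finset.sum_eq_single 0 (by intro k _ hk; simp [hk]) (by simp)] at this
      simp only [pow_zero, mul_one] at this
      exact this.mono_left nhdsWithin_le_nhds
    have l1 : Filter.Tendsto (fun s : ℝ => (s * R + 1) ^ n * kappa n) (nhdsWithin 0 (Set.Ioi 0)) (nhds (kappa n)) := by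
      have hcont : Continuous (fun s : ℝ => (s * R + 1) ^ n * kappa n) := by fun_prop
      have := hcont.tendsto 0
      simp only [zero_mul, zero_add, one_pow, one_mul] at this
      exact this.mono_left nhdsWithin_le_nhds
    have l2 : Filter.Tendsto (fun s : ℝ => ∑ k ∈ Finset.range (n + 1), β k * s ^ k) (nhdsWithin 0 (Set.Ioi 0)) (nhds (kappa n)) := by
      refine tendsto_of_tendsto_of_tendsto_of_le_of_le' tendsto_const_nhds l1 ?_ ?_
      · filter_upwards [self_mem_nhdsWithin] with s hs
        have hs : 0 < s := hs
        rw [← hβ s hs, ← kappa_closed]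
        refine vF_mono_set (hKc s) ?_
        intro x hx
        exact Set.mem_add.2 ⟨0, ⟨0, h0K, by simp⟩, x, hx, zero_add x⟩
      · filter_upwards [self_mem_nhdsWithin] with s hs
        have hs : 0 < s := hs
        rw [← hβ s hs, ← kappa_closed, ← vol_smul _ _ (by positivity)]
        refine vF_mono_set ((isCompact_closedBall _ _).smul _) ?_
        rw [← smul_ball_sub _ (by positivity)]
        rintro _ ⟨_, ⟨x, hx, rfl⟩, y, hy, rfl⟩
        have hx' := hR hx
        rw [mem_closedBall_zero_iff] at hx' hy ⊢
        calc ‖s • x + y‖ ≤ ‖s • x‖ + ‖y‖ := norm_add_le _ _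
          _ ≤ s * R + 1 := by rw [norm_smul, Real.norm_of_nonneg hs.le]; gcongr
    exact tendsto_nhds_unique l0 l2
  refine ⟨ge_of_tendsto' (hconv j (by omega)) fun m => hb0 m j,
    ge_of_tendsto' (hconv (j+1) hjn) fun m => hb0 m _, ?_⟩
  rw [← hβ0]
  exact le_of_tendsto_of_tendsto' ((((hconv (j+1) hjn).div_const _).pow j).mul (hconv 0 (by omega)))
    (((hconv j (by omega)).div_const _).pow (j+1)) fun m => hb2 m j hjn hj1

lemma final_arith (j : ℕ) (hj : 1 ≤ j) (kn k1 k2 C1 C2 v1 v2 : ℝ) (hkn : 0 < kn) (hk1 : 0 < k1) (hk2 : 0 < k2)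
    (hC1 : 0 < C1) (hC2 : 0 < C2) (hv1 : 0 ≤ v1) (hv2 : 0 ≤ v2)
    (h : (k2 * v2 / C2) ^ j * kn ≤ (k1 * v1 / C1) ^ (j + 1)) :
    v2 ≤ kn ^ (-(1 : ℝ) / j) * k2⁻¹ * k1 ^ (((j : ℝ) + 1) / j) * C2 * C1 ^ (-(((j : ℝ) + 1) / j))
          * v1 ^ (((j : ℝ) + 1) / j) := by
  have hj0 : (0:ℝ) < j := by exact_mod_cast hj
  set A := k2 * v2 / C2 with hA
  set D := k1 * v1 / C1 with hD
  have hA0 : 0 ≤ A := by positivity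
  have hD0 : 0 ≤ D := by positivity
  have h1 : A ^ j ≤ D ^ (j+1) / kn := by rwa [le_div_iff₀ hkn]
  have h2 : A ≤ (D ^ (j+1) / kn) ^ (1 / (j:ℝ)) := by
    have := Real.rpow_le_rpow (by positivity) h1 (show 0 ≤ 1 / (j:ℝ) by positivity)
    rwa [← Real.rpow_natCast, ← Real.rpow_mul hA0, mul_one_div_cancel hj0.ne', Real.rpow_one] at this
  have h3 : (D ^ (j+1) / kn) ^ (1 / (j:ℝ)) = kn ^ (-(1 : ℝ) / j) * D ^ (((j : ℝ) + 1) / j) := by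
    rw [Real.div_rpow (by positivity) hkn.le, ← Real.rpow_natCast, ← Real.rpow_mul hD0, neg_div,
      Real.rpow_neg hkn.le, div_eq_mul_inv, mul_comm]
    congr 2
    push_cast; ring
  have h4 : D ^ (((j : ℝ) + 1) / j) = k1 ^ (((j : ℝ) + 1) / j) * v1 ^ (((j : ℝ) + 1) / j) * C1 ^ (-(((j : ℝ) + 1) / j)) := by
    rw [hD, Real.div_rpow (by positivity) hC1.le, Real.mul_rpow hk1.le hv1, Real.rpow_neg hC1.le, div_eq_mul_inv]
  rw [h3, h4] at h2
  have h5 : v2 = A * (k2⁻¹ * C2) := by rw [hA]; field_simp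
  rw [h5]
  calc A * (k2⁻¹ * C2) ≤ _ := mul_le_mul_of_nonneg_right h2 (by positivity)
    _ = _ := by ring

/-- A special case of the Aleksandrov–Fenchel inequality:
`V_{j+1}(K) ≤ C_{n,j} V_j(K)^{(j+1)/j}`. -/
theorem aleksandrov_fenchel_special (n j : ℕ) (hn : 2 ≤ n) (hj1 : 1 ≤ j) (hjn : j ≤ n - 1)
    (V : ℕ → Set (Euc n) → ℝ) (hV : steiner n V)
    (K : Set (Euc n)) (hKcp : IsCompact K) (hKcv : Convex ℝ K)
    (hKint : (interior K).Nonempty) :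
    V (j + 1) K
      ≤ kappa n ^ (-(1 : ℝ) / j) * (kappa (n - j - 1))⁻¹
          * kappa (n - j) ^ (((j : ℝ) + 1) / j)
          * (n.choose (j + 1) : ℝ) * (n.choose j : ℝ) ^ (-(((j : ℝ) + 1) / j))
          * V j K ^ (((j : ℝ) + 1) / j) := by
  obtain ⟨p, hp⟩ := hKint
  obtain ⟨r, hr, hrK⟩ := Metric.nhds_basis_closedBall.mem_iff.1 (mem_interior_iff_mem_nhds.1 hp)
  set K₀ : Set (Euc n) := {-p} + K with hK0
  have hball : closedBall (0 : Euc n) r ⊆ K₀ := by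
    intro x hx
    refine Set.mem_add.2 ⟨-p, rfl, p + x, hrK ?_, by abel⟩
    rw [mem_closedBall_iff_norm]
    simpa using hx
  have hβ : ∀ s : ℝ, 0 < s → (volume (s • K₀ + closedBall (0 : Euc n) 1)).toReal =
      ∑ k ∈ Finset.range (n + 1), (kappa (n - k) * V k K) * s ^ k := by
    intro s hs
    have e1 : s • K₀ + closedBall (0 : Euc n) 1 = (fun x => s • (-p) + x) '' (s • (K + closedBall (0 : Euc n) s⁻¹)) := by
      rw [hK0, smul_add, smul_add, _root_.smul_closedBall _ _ (by positivity), smul_zero, Real.norm_of_nonneg hs.le,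
        mul_inv_cancel₀ hs.ne', Set.smul_set_singleton, ← Set.singleton_add, add_assoc]
    rw [e1, Set.image_add_left, measure_preimage_add, vol_smul _ _ hs.le,
      hV K hKcp hKcv ⟨p, interior_subset hp⟩ s⁻¹ (by positivity), Finset.mul_sum]
    refine Finset.sum_congr rfl fun k hk => ?_
    have hk' : k ≤ n := by have := Finset.mem_range.1 hk; omega
    have : s ^ n = s ^ (n - k) * s ^ k := by rw [← pow_add]; congr 1; omega
    rw [this, inv_pow]
    field_simp
  obtain ⟨b1, b2, b3⟩ := limit_ineq (by omega) K₀ (isCompact_singleton.add hKcp) ((convex_singleton _).add hKcv)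
    r hr hball _ hβ j hj1 (by omega)
  have hch : ∀ k ≤ n, (0:ℝ) < n.choose k := fun k hk => by exact_mod_cast Nat.choose_pos hk
  rw [show n - j - 1 = n - (j + 1) by omega]
  exact final_arith j hj1 _ _ _ _ _ _ _ (kappa_pos _) (kappa_pos _) (kappa_pos _) (hch _ (by omega)) (hch _ (by omega))
    (nonneg_of_mul_nonneg_right b1 (kappa_pos _)) (nonneg_of_mul_nonneg_right b2 (kappa_pos _)) b3

end
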